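/- (Vopěnka) Assume ZFC. For every set of ordinals A there exist a forcing ℙ ∈ HOD and a filter G which is (HOD,ℙ)-generic, such that A ∈ HOD[G] and HOD[G] ⊆ V; moreover ℙ can be taken to be definable (an isomorph, via ordinal codes, of the partial order of nonempty OD subsets of P(sup A + 1) ordered by inclusion), and G is definable from A and ℙ. -/

import Mathlib

open ZFSet

/-- A class of sets. -/
abbrev ZClass := Set ZFSet

/-- A class is transitive. -/
def ClassTransitive (N : ZClass) : Prop := ∀ x ∈ N, ∀ y : ZFSet, y ∈ x → y ∈ N

/-- A set is a (von Neumann) ordinal: transitive set of transitive sets. -/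
def ZOrd (x : ZFSet) : Prop := x.IsTransitive ∧ ∀ y ∈ x, ZFSet.IsTransitive y

/-- First-order formulas in the language of set theory (variables are natural numbers). -/
inductive Fml : Type
  | mem : ℕ → ℕ → Fml
  | eq : ℕ → ℕ → Fml
  | impl : Fml → Fml → Fml
  | not : Fml → Fml
  | all : ℕ → Fml → Fml

/-- Satisfaction of a formula in a class `N` (with `∈` the real membership),
quantifiers relativized to `N`. -/
def FmlSat (N : ZClass) : Fml → (ℕ → ZFSet) → Prop
  | .mem i j, v => v i ∈ v j
  | .eq i j, v => v i = v j
  | .impl φ ψ, v => FmlSat N φ v → FmlSat N ψ v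
  | .not φ, v => ¬ FmlSat N φ v
  | .all n φ, v => ∀ x ∈ N, FmlSat N φ (Function.update v n x)

/-- `r` (a set of Kuratowski pairs) well-orders the set `x`. -/
def WellOrders (r x : ZFSet) : Prop :=
  (∀ a ∈ x, ∀ b ∈ x, a = b ∨ ZFSet.pair a b ∈ r ∨ ZFSet.pair b a ∈ r) ∧
  (∀ y : ZFSet, y ⊆ x → y ≠ ∅ → ∃ a, a ∈ y ∧ ∀ b ∈ y, a = b ∨ ZFSet.pair a b ∈ r)

/-- `N` is a (transitive-class) model of ZFC: closure under the ZFC axioms,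
with separation and replacement as first-order schemas (relativized to `N`)
and choice in the guise of the wellordering principle. -/
structure ModelsZFC (N : ZClass) : Prop where
  empty_mem : (∅ : ZFSet) ∈ N
  omega_mem : ZFSet.omega ∈ N
  pair_mem : ∀ x ∈ N, ∀ y ∈ N, ({x, y} : ZFSet) ∈ N
  union_mem : ∀ x ∈ N, ZFSet.sUnion x ∈ N
  power_mem : ∀ x ∈ N, ZFSet.sep (fun y => y ∈ N) (ZFSet.powerset x) ∈ N
  sep_mem : ∀ (φ : Fml) (v : ℕ → ZFSet), (∀ n, v n ∈ N) → ∀ x ∈ N,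
      ZFSet.sep (fun y => FmlSat N φ (Function.update v 0 y)) x ∈ N
  repl_mem : ∀ (φ : Fml) (v : ℕ → ZFSet), (∀ n, v n ∈ N) → ∀ x ∈ N,
      ∃ z ∈ N, ∀ b : ZFSet, b ∈ z ↔
        (b ∈ N ∧ ∃ a : ZFSet, a ∈ x ∧
          FmlSat N φ (Function.update (Function.update v 0 a) 1 b) ∧
          ∀ b' ∈ N, FmlSat N φ (Function.update (Function.update v 0 a) 1 b') → b' = b)
  choice_wo : ∀ x ∈ N, ∃ r ∈ N, WellOrders r x

/-- `le` is (the graph of) a partial order on (the members of) `P`. -/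
structure ZPoset (P le : ZFSet) : Prop where
  rel : ∀ z ∈ le, ∃ p, p ∈ P ∧ ∃ q, q ∈ P ∧ z = ZFSet.pair p q
  refl : ∀ p ∈ P, ZFSet.pair p p ∈ le
  antisymm : ∀ p q : ZFSet, ZFSet.pair p q ∈ le → ZFSet.pair q p ∈ le → p = q
  trans : ∀ p q r : ZFSet, ZFSet.pair p q ∈ le → ZFSet.pair q r ∈ le → ZFSet.pair p r ∈ le

/-- `G` is a filter on the poset `(P, le)`. -/
def ZFilter (P le : ZFSet) (G : Set ZFSet) : Prop :=
  (∀ p ∈ G, p ∈ P) ∧ G.Nonempty ∧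
  (∀ p ∈ G, ∀ q : ZFSet, q ∈ P → ZFSet.pair p q ∈ le → q ∈ G) ∧
  (∀ p ∈ G, ∀ q ∈ G, ∃ r ∈ G, ZFSet.pair r p ∈ le ∧ ZFSet.pair r q ∈ le)

/-- `D` is a dense subset of the poset `(P, le)`. -/
def ZDense (P le D : ZFSet) : Prop :=
  D ⊆ P ∧ ∀ p ∈ P, ∃ q, q ∈ D ∧ ZFSet.pair q p ∈ le

/-- `G` is an `(N, P)`-generic filter: it meets every dense subset of `P` lying in `N`. -/
def ZGeneric (N : ZClass) (P le : ZFSet) (G : Set ZFSet) : Prop :=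
  ZFilter P le G ∧ ∀ D ∈ N, ZDense P le D → ∃ p ∈ G, p ∈ D

/-- The set `g` codes the (sub)class `G`. -/
def Codes (g : ZFSet) (G : Set ZFSet) : Prop := ∀ p : ZFSet, p ∈ g ↔ p ∈ G

/-- `NG` is the generic extension `N[G]`: the least transitive ZFC class model
containing `N` and (a set coding) `G`. -/
def IsGenericExt (N : ZClass) (G : Set ZFSet) (NG : ZClass) : Prop :=
  ClassTransitive NG ∧ ModelsZFC NG ∧ N ⊆ NG ∧ (∃ g ∈ NG, Codes g G) ∧
  ∀ N' : ZClass, ClassTransitive N' → ModelsZFC N' → N ⊆ N' → (∃ g ∈ N', Codes g G) → NG ⊆ N'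

/-- `f` is (the graph of) a surjection from `a` onto `b`. -/
def ZSurj (a b f : ZFSet) : Prop :=
  ZFSet.IsFunc a b f ∧ ∀ y ∈ b, ∃ x, x ∈ a ∧ ZFSet.pair x y ∈ f

/-- `x` is ordinal definable: some formula with ordinal parameters defines `{x}` in `V`. -/
def ZOD (x : ZFSet) : Prop :=
  ∃ (φ : Fml) (v : ℕ → ZFSet), (∀ n, ZOrd (v n)) ∧
    ∀ y : ZFSet, FmlSat Set.univ φ (Function.update v 0 y) ↔ y = x

/-- `x` is hereditarily ordinal definable. -/
inductive InHOD : ZFSet → Prop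
  | mk (x : ZFSet) : ZOD x → (∀ y ∈ x, InHOD y) → InHOD x

/-- The class HOD of hereditarily ordinal definable sets. -/
def HODc : ZClass := {x | InHOD x}

/-- `x` is ordinal definable from the parameter `a`. -/
def ZODp (a x : ZFSet) : Prop :=
  ∃ (φ : Fml) (v : ℕ → ZFSet), (∀ n, ZOrd (v n) ∨ v n = a) ∧
    ∀ y : ZFSet, FmlSat Set.univ φ (Function.update v 0 y) ↔ y = x

/-- `x` is hereditarily ordinal definable from the parameter `a`. -/
inductive InHODp (a : ZFSet) : ZFSet → Prop
  | mk (x : ZFSet) : ZODp a x → (∀ y ∈ x, InHODp a y) → InHODp a x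

/-- A Vopěnka condition relative to the ordinal `η`: a nonempty OD set of subsets
of `η`. -/
def VCond (η B : ZFSet) : Prop := ZOD B ∧ B ≠ ∅ ∧ B ⊆ ZFSet.powerset η

/-- The map `c` is ordinal definable (as a class function) on the domain `Dom`. -/
def ODMap (c : ZFSet → ZFSet) (Dom : Set ZFSet) : Prop :=
  ∃ (φ : Fml) (v : ℕ → ZFSet), (∀ n, ZOrd (v n)) ∧
    ∀ B ∈ Dom, ∀ y : ZFSet,
      FmlSat Set.univ φ (Function.update (Function.update v 0 B) 1 y) ↔ y = c B

namespace Vopenka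

universe u

section

/-! ### Formulas and renaming of variables -/

/-- Assignments of sets to variables. -/
abbrev Val := ℕ → ZFSet.{u}

/-- Drop the first entry of an assignment. -/
def tail (v : Val.{u}) : Val.{u} := fun n => v (n + 1)

/-- Add a first entry to an assignment. -/
def cons (x : ZFSet.{u}) (v : Val.{u}) : Val.{u}
  | 0 => x
  | n + 1 => v n

@[simp] theorem cons_zero (x : ZFSet.{u}) (v : Val.{u}) : cons x v 0 = x := rfl
@[simp] theorem cons_succ (x : ZFSet.{u}) (v : Val.{u}) (n : ℕ) : cons x v (n + 1) = v n := rfl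
@[simp] theorem tail_cons (x : ZFSet.{u}) (v : Val.{u}) : tail (cons x v) = v := rfl

/-- A strict upper bound for the variables of a formula. -/
def bd : Fml → ℕ
  | .mem i j => max i j + 1
  | .eq i j => max i j + 1
  | .impl φ ψ => max (bd φ) (bd ψ)
  | .not φ => bd φ
  | .all n φ => max (n + 1) (bd φ)

theorem sat_congr (N : ZClass.{u}) (φ : Fml) :
    ∀ v w : Val.{u}, (∀ n < bd φ, v n = w n) → (FmlSat N φ v ↔ FmlSat N φ w) := by
  induction φ with
  | mem i j =>
    intro v w h
    simp only [FmlSat, bd] at *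
    rw [h i (by omega), h j (by omega)]
  | eq i j =>
    intro v w h
    simp only [FmlSat, bd] at *
    rw [h i (by omega), h j (by omega)]
  | impl φ ψ ih₁ ih₂ =>
    intro v w h
    simp only [FmlSat, bd] at *
    rw [ih₁ v w fun n hn => h n (by omega), ih₂ v w fun n hn => h n (by omega)]
  | not φ ih =>
    intro v w h
    simp only [FmlSat, bd] at *
    rw [ih v w h]
  | all n φ ih =>
    intro v w h
    simp only [FmlSat, bd] at *
    refine forall₂_congr fun x _ => ih _ _ fun m hm => ?_
    by_cases e : m = n
    · subst e; simp
    · simp only [Function.update_of_ne e]; exact h m (by omega)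

theorem exists_rename (N : ZClass.{u}) (φ : Fml) : ∀ f : ℕ → ℕ, ∃ ψ : Fml,
    ∀ v : Val.{u}, FmlSat N ψ v ↔ FmlSat N φ (fun n => v (f n)) := by
  induction φ with
  | mem i j => exact fun f => ⟨.mem (f i) (f j), fun v => Iff.rfl⟩
  | eq i j => exact fun f => ⟨.eq (f i) (f j), fun v => Iff.rfl⟩
  | impl φ ψ ih₁ ih₂ =>
    intro f
    obtain ⟨φ', h₁⟩ := ih₁ f
    obtain ⟨ψ', h₂⟩ := ih₂ f
    exact ⟨.impl φ' ψ', fun v => by simp only [FmlSat, h₁, h₂]⟩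
  | not φ ih =>
    intro f
    obtain ⟨φ', h⟩ := ih f
    exact ⟨.not φ', fun v => by simp only [FmlSat, h]⟩
  | all n φ ih =>
    intro f
    obtain ⟨m, hm⟩ : ∃ m, ∀ i < bd φ, f i < m := by
      refine ⟨(Finset.range (bd φ)).sup f + 1, fun i hi => Nat.lt_succ_of_le ?_⟩
      exact Finset.le_sup (f := f) (Finset.mem_range.2 hi)
    obtain ⟨ψ, h⟩ := ih (Function.update f n m)
    refine ⟨.all m ψ, fun v => ?_⟩
    simp only [FmlSat, h]
    refine forall₂_congr fun x _ => sat_congr N φ _ _ fun i hi => ?_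
    by_cases e : i = n
    · subst e; simp
    · simp only [Function.update_of_ne e]
      exact Function.update_of_ne (hm i hi).ne _ _

/-! ### Definable relations and functions over a transitive class -/

/-- `R` is defined over the class `N` by a formula without parameters. -/
class DefP (N : ZClass.{u}) (R : Val.{u} → Prop) : Prop where
  out : ∃ φ : Fml, ∀ v : Val.{u}, (∀ n, v n ∈ N) → (FmlSat N φ v ↔ R v)

/-- `t` maps assignments in `N` to elements of `N`, and membership in its values is defined
over `N` by a formula without parameters. -/
class DefF (N : ZClass.{u}) (t : Val.{u} → ZFSet.{u}) : Prop where
  closed : ∀ v : Val.{u}, (∀ n, v n ∈ N) → t v ∈ N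
  mem : DefP N fun v => v 0 ∈ t (tail v)

/-- The map `s` on assignments is a renaming of variables. -/
class IsRenaming (s : Val.{u} → Val.{u}) : Prop where
  out : ∃ f : ℕ → ℕ, ∀ v n, s v n = v (f n)

/-- Transitivity of a class, as a type class. -/
class TransClass (N : ZClass.{u}) : Prop where
  out : ClassTransitive N

instance : TransClass (Set.univ : ZClass.{u}) := ⟨fun _ _ _ _ => trivial⟩

instance : IsRenaming (fun v : Val.{u} => v) := ⟨⟨id, fun _ _ => rfl⟩⟩

instance : IsRenaming (tail : Val.{u} → Val.{u}) := ⟨⟨(· + 1), fun _ _ => rfl⟩⟩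

instance (s : Val.{u} → Val.{u}) [h : IsRenaming s] : IsRenaming (fun v => tail (s v)) :=
  let ⟨f, hf⟩ := h.out
  ⟨⟨fun n => f (n + 1), fun v n => hf v (n + 1)⟩⟩

instance (s t : Val.{u} → Val.{u}) [hs : IsRenaming s] [ht : IsRenaming t] (i : ℕ) :
    IsRenaming (fun v => cons (s v i) (t v)) :=
  let ⟨f, hf⟩ := hs.out
  let ⟨g, hg⟩ := ht.out
  ⟨⟨fun n => if n = 0 then f i else g (n - 1), fun v n => by cases n <;> simp [hf, hg]⟩⟩

theorem IsRenaming.comp (s t : Val.{u} → Val.{u}) [hs : IsRenaming s] [ht : IsRenaming t] :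
    IsRenaming (fun v => s (t v)) :=
  let ⟨f, hf⟩ := hs.out
  let ⟨g, hg⟩ := ht.out
  ⟨⟨fun n => g (f n), fun v n => by rw [hf, hg]⟩⟩

variable {N : ZClass.{u}}

theorem DefP.congr {R S : Val.{u} → Prop} (h : DefP N R)
    (e : ∀ v, (∀ n, v n ∈ N) → (R v ↔ S v)) : DefP N S :=
  let ⟨φ, hφ⟩ := h.out
  ⟨⟨φ, fun v hv => (hφ v hv).trans (e v hv)⟩⟩

theorem DefP.rename {R : Val.{u} → Prop} (h : DefP N R) (s : Val.{u} → Val.{u})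
    [hs : IsRenaming s] : DefP N fun v => R (s v) := by
  obtain ⟨φ, hφ⟩ := h.out
  obtain ⟨f, hf⟩ := hs.out
  obtain ⟨ψ, hψ⟩ := exists_rename N φ f
  refine ⟨⟨ψ, fun v hv => ?_⟩⟩
  rw [hψ, hφ _ fun n => hv (f n)]
  exact iff_of_eq (congrArg R (funext fun n => (hf v n).symm))

instance DefP.not {R : Val.{u} → Prop} [h : DefP N R] : DefP N fun v => ¬ R v :=
  let ⟨φ, hφ⟩ := h.out
  ⟨⟨.not φ, fun v hv => not_congr (hφ v hv)⟩⟩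

instance DefP.imp {R S : Val.{u} → Prop} [h : DefP N R] [h' : DefP N S] :
    DefP N fun v => R v → S v :=
  let ⟨φ, hφ⟩ := h.out
  let ⟨ψ, hψ⟩ := h'.out
  ⟨⟨.impl φ ψ, fun v hv => imp_congr (hφ v hv) (hψ v hv)⟩⟩

instance DefP.and {R S : Val.{u} → Prop} [DefP N R] [DefP N S] :
    DefP N fun v => R v ∧ S v :=
  (inferInstance : DefP N fun v => ¬ (R v → ¬ S v)).congr fun _ _ => by tauto

instance DefP.or {R S : Val.{u} → Prop} [DefP N R] [DefP N S] :
    DefP N fun v => R v ∨ S v :=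
  (inferInstance : DefP N fun v => ¬ R v → S v).congr fun _ _ => by tauto

instance DefP.iff {R S : Val.{u} → Prop} [h : DefP N R] [h' : DefP N S] :
    DefP N fun v => R v ↔ S v :=
  (inferInstance : DefP N fun v => (R v → S v) ∧ (S v → R v)).congr fun _ _ => by tauto

/-- Quantification over `N`. -/
theorem DefP.forall_mem_class {R : Val.{u} → ZFSet.{u} → Prop}
    (h : DefP N fun v => R (tail v) (v 0)) : DefP N fun v => ∀ x ∈ N, R v x := by
  obtain ⟨φ, hφ⟩ := h.out
  obtain ⟨ψ, hψ⟩ := exists_rename N φ fun i => if i = 0 then bd φ else i - 1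
  refine ⟨⟨.all (bd φ) ψ, fun v hv => forall₂_congr fun x hx => ?_⟩⟩
  have hc : ∀ n, cons x v n ∈ N := fun n => by
    cases n
    · exact hx
    · exact hv _
  rw [hψ, ← (show R (tail (cons x v)) (cons x v 0) ↔ R v x from Iff.rfl), ← hφ _ hc]
  refine sat_congr N φ _ _ fun i hi => ?_
  rcases i with _ | i
  · simp
  · simp only [Nat.add_eq_zero_iff, one_ne_zero, and_false, if_false, Nat.add_sub_cancel, cons_succ]
    exact Function.update_of_ne (by omega) _ _

theorem DefP.exists_mem_class {R : Val.{u} → ZFSet.{u} → Prop}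
    (h : DefP N fun v => R (tail v) (v 0)) : DefP N fun v => ∃ x ∈ N, R v x :=
  (DefP.not (h := DefP.forall_mem_class (R := fun v x => ¬ R v x) DefP.not)).congr
    fun _ _ => by push Not; rfl

instance DefP.all {R : Val.{u} → ZFSet.{u} → Prop}
    [h : DefP Set.univ fun v => R (tail v) (v 0)] : DefP Set.univ fun v => ∀ x, R v x :=
  (DefP.forall_mem_class h).congr fun _ _ => by simp

instance DefP.ex {R : Val.{u} → ZFSet.{u} → Prop}
    [h : DefP Set.univ fun v => R (tail v) (v 0)] : DefP Set.univ fun v => ∃ x, R v x :=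
  (DefP.exists_mem_class h).congr fun _ _ => by simp

instance DefF.var (s : Val.{u} → Val.{u}) [hs : IsRenaming s] (i : ℕ) :
    DefF N fun v => s v i where
  closed v hv := by
    obtain ⟨f, hf⟩ := hs.out
    rw [hf]; exact hv _
  mem := by
    obtain ⟨f, hf⟩ := hs.out
    refine ⟨⟨.mem 0 (f i + 1), fun v _ => ?_⟩⟩
    simp only [FmlSat, hf, tail]

theorem DefF.rename {t : Val.{u} → ZFSet.{u}} (h : DefF N t) (s : Val.{u} → Val.{u})
    [hs : IsRenaming s] : DefF N fun v => t (s v) where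
  closed v hv := h.closed _ fun n => by
    obtain ⟨f, hf⟩ := hs.out
    rw [hf]; exact hv _
  mem :=
    have := IsRenaming.comp s tail
    h.mem.rename fun v : Val.{u} => cons (v 0) (s (tail v))

instance DefP.forall_class {R : Val.{u} → ZFSet.{u} → Prop}
    [h : DefP N fun v => R (tail v) (v 0)] : DefP N fun v => ∀ x, x ∈ N → R v x :=
  DefP.forall_mem_class h

instance DefP.exists_class {R : Val.{u} → ZFSet.{u} → Prop}
    [h : DefP N fun v => R (tail v) (v 0)] : DefP N fun v => ∃ x, x ∈ N ∧ R v x :=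
  DefP.exists_mem_class h

variable [hN : TransClass N]

/-- Substitution of a definable function for the first variable of a definable relation. -/
theorem DefP.subst {R : Val.{u} → Prop} (h : DefP N R) {t : Val.{u} → ZFSet.{u}}
    (ht : DefF N t) : DefP N fun v => R (cons (t v) v) := by
  have h₁ : DefP N fun v => ∀ w ∈ N, (w ∈ v 0 ↔ w ∈ t (tail v)) := by
    refine DefP.forall_mem_class (R := fun v w => (w ∈ v 0 ↔ w ∈ t (tail v))) ?_
    have h₂ := ht.mem.rename fun v : Val.{u} => cons (v 0) (tail (tail v))
    have h₃ : DefP N fun v => v 0 ∈ v 1 := ⟨⟨.mem 0 1, fun v _ => Iff.rfl⟩⟩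
    exact DefP.iff (h := h₃) (h' := h₂)
  have h₂ : DefP N fun v => R (cons (v 0) (tail v)) := h.rename fun v => cons (v 0) (tail v)
  refine (DefP.exists_mem_class (R := fun v y => (∀ w ∈ N, (w ∈ y ↔ w ∈ t v)) ∧ R (cons y v))
    DefP.and).congr fun v hv => ?_
  constructor
  · rintro ⟨y, hy, hyt, hR⟩
    have : y = t v := by
      ext w
      exact ⟨fun hw => (hyt w (hN.out y hy w hw)).1 hw,
        fun hw => (hyt w (hN.out _ (ht.closed v hv) w hw)).2 hw⟩
    exact this ▸ hR
  · exact fun hR => ⟨t v, ht.closed v hv, fun _ _ => Iff.rfl, hR⟩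

theorem DefF.subst {s : Val.{u} → ZFSet.{u}} (hs : DefF N s) {t : Val.{u} → ZFSet.{u}}
    (ht : DefF N t) : DefF N fun v => s (cons (t v) v) where
  closed v hv := hs.closed _ fun n => by
    cases n
    · exact ht.closed v hv
    · exact hv _
  mem := (hs.mem.rename fun w => cons (w 1) (cons (w 0) (tail (tail w)))).subst (ht.rename tail)

variable {r s t q : Val.{u} → ZFSet.{u}}

theorem DefP.comp₁ {R : ZFSet.{u} → Prop} (h : DefP N fun v => R (v 0)) (hs : DefF N s) :
    DefP N fun v => R (s v) :=
  h.subst hs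

theorem DefP.comp₂ {R : ZFSet.{u} → ZFSet.{u} → Prop} (h : DefP N fun v => R (v 0) (v 1))
    (hs : DefF N s) (ht : DefF N t) : DefP N fun v => R (s v) (t v) :=
  (h.subst (hs.rename tail)).subst ht

theorem DefP.comp₃ {R : ZFSet.{u} → ZFSet.{u} → ZFSet.{u} → Prop}
    (h : DefP N fun v => R (v 0) (v 1) (v 2))
    (hr : DefF N r) (hs : DefF N s) (ht : DefF N t) : DefP N fun v => R (r v) (s v) (t v) :=
  ((h.subst (hr.rename fun v => tail (tail v))).subst (hs.rename tail)).subst ht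

theorem DefF.comp₁ {f : ZFSet.{u} → ZFSet.{u}} (h : DefF N fun v => f (v 0)) (hs : DefF N s) :
    DefF N fun v => f (s v) :=
  h.subst hs

theorem DefF.comp₂ {f : ZFSet.{u} → ZFSet.{u} → ZFSet.{u}} (h : DefF N fun v => f (v 0) (v 1))
    (hs : DefF N s) (ht : DefF N t) : DefF N fun v => f (s v) (t v) :=
  (h.subst (hs.rename tail)).subst ht

theorem DefF.comp₃ {f : ZFSet.{u} → ZFSet.{u} → ZFSet.{u} → ZFSet.{u}}
    (h : DefF N fun v => f (v 0) (v 1) (v 2))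
    (hr : DefF N r) (hs : DefF N s) (ht : DefF N t) : DefF N fun v => f (r v) (s v) (t v) :=
  ((h.subst (hr.rename fun v => tail (tail v))).subst (hs.rename tail)).subst ht

theorem DefF.comp₄ {f : ZFSet.{u} → ZFSet.{u} → ZFSet.{u} → ZFSet.{u} → ZFSet.{u}}
    (h : DefF N fun v => f (v 0) (v 1) (v 2) (v 3))
    (hq : DefF N q) (hr : DefF N r) (hs : DefF N s) (ht : DefF N t) :
    DefF N fun v => f (q v) (r v) (s v) (t v) :=
  (((h.subst (hq.rename fun v => tail (tail (tail v)))).subst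
    (hr.rename fun v => tail (tail v))).subst (hs.rename tail)).subst ht

instance DefP.mem [hs : DefF N s] [ht : DefF N t] : DefP N fun v => s v ∈ t v :=
  DefP.comp₂ (R := fun x y => x ∈ y) ⟨⟨.mem 0 1, fun _ _ => Iff.rfl⟩⟩ hs ht

instance DefP.eq [hs : DefF N s] [ht : DefF N t] : DefP N fun v => s v = t v :=
  DefP.comp₂ (R := fun x y => x = y) ⟨⟨.eq 0 1, fun _ _ => Iff.rfl⟩⟩ hs ht

instance DefP.forall_mem {R : Val.{u} → ZFSet.{u} → Prop} [hs : DefF N s]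
    [h : DefP N fun v => R (tail v) (v 0)] : DefP N fun v => ∀ x, x ∈ s v → R v x := by
  have := hs.mem
  refine (inferInstance : DefP N fun v => ∀ x ∈ N, x ∈ s v → R v x).congr fun v hv => ?_
  exact ⟨fun h x hx => h x (hN.out _ (hs.closed v hv) x hx) hx, fun h x _ => h x⟩

instance DefP.exists_mem {R : Val.{u} → ZFSet.{u} → Prop} [hs : DefF N s]
    [h : DefP N fun v => R (tail v) (v 0)] : DefP N fun v => ∃ x, x ∈ s v ∧ R v x := by
  have := hs.mem
  refine (inferInstance : DefP N fun v => ∃ x ∈ N, x ∈ s v ∧ R v x).congr fun v hv => ?_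
  exact ⟨fun ⟨x, _, hx⟩ => ⟨x, hx⟩, fun ⟨x, hx⟩ => ⟨x, hN.out _ (hs.closed v hv) x hx.1, hx⟩⟩

instance DefP.subset [hs : DefF N s] [ht : DefF N t] : DefP N fun v => s v ⊆ t v :=
  DefP.comp₂ (R := fun x y => x ⊆ y)
    ((inferInstance : DefP N fun v => ∀ x, x ∈ v 0 → x ∈ v 1).congr fun _ _ => Iff.rfl) hs ht

end

section

variable {N : ZClass.{u}} {s t : Val.{u} → ZFSet.{u}}

/-! ### Definability of basic set operations -/

/-- Closure of a class under unordered pairs, as a type class. -/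
class PairClosed (N : ZClass.{u}) : Prop where
  out : ∀ x ∈ N, ∀ y ∈ N, ({x, y} : ZFSet.{u}) ∈ N

instance : PairClosed (Set.univ : ZClass.{u}) := ⟨fun _ _ _ _ => trivial⟩

instance defF_upair [TransClass N] [hp : PairClosed N] [hs : DefF N s] [ht : DefF N t] :
    DefF N fun v => {s v, t v} :=
  DefF.comp₂ (f := fun x y => {x, y})
    ⟨fun _ hv => hp.out _ (hv 0) _ (hv 1),
      (inferInstance : DefP N fun v => v 0 = v 1 ∨ v 0 = v 2).congr fun _ _ => by simp [tail]⟩ hs ht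

instance defF_singleton [TransClass N] [PairClosed N] [hs : DefF N s] :
    DefF N fun v => {s v} := by
  simpa only [pair_eq_singleton] using (inferInstance : DefF N fun v => {s v, s v})

instance defF_pair [TransClass N] [PairClosed N] [hs : DefF N s] [ht : DefF N t] :
    DefF N fun v => ZFSet.pair (s v) (t v) :=
  (inferInstance : DefF N fun v => {{s v}, {s v, t v}})

theorem DefF.of_mem (h : DefP Set.univ fun v => v 0 ∈ t (tail v)) : DefF Set.univ t :=
  ⟨fun _ _ => trivial, h⟩

theorem DefF.of_mem_iff {R : Val.{u} → Prop} (h : DefP Set.univ R)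
    (e : ∀ v, R v ↔ v 0 ∈ t (tail v)) : DefF Set.univ t :=
  DefF.of_mem (h.congr fun v _ => e v)

instance defF_empty : DefF Set.univ fun _ : Val.{u} => (∅ : ZFSet.{u}) :=
  DefF.of_mem_iff (inferInstance : DefP Set.univ fun v => ¬ v 0 = v 0) fun v => by simp

instance defF_insert [hs : DefF Set.univ s] [ht : DefF Set.univ t] :
    DefF Set.univ fun v => insert (s v) (t v) :=
  DefF.comp₂ (f := fun x y => insert x y)
    (DefF.of_mem_iff (inferInstance : DefP Set.univ fun v => v 0 = v 1 ∨ v 0 ∈ v 2)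
      fun v => by simp [tail]) hs ht

instance defF_sUnion [hs : DefF Set.univ s] : DefF Set.univ fun v => ZFSet.sUnion (s v) :=
  DefF.comp₁ (f := ZFSet.sUnion)
    (DefF.of_mem_iff (inferInstance : DefP Set.univ fun v => ∃ y, y ∈ v 1 ∧ v 0 ∈ y)
      fun v => by simp [tail]) hs

instance defF_powerset [hs : DefF Set.univ s] : DefF Set.univ fun v => ZFSet.powerset (s v) :=
  DefF.comp₁ (f := ZFSet.powerset)
    (DefF.of_mem_iff (inferInstance : DefP Set.univ fun v => v 0 ⊆ v 1)
      fun v => by simp [tail]) hs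

instance defF_prod [hs : DefF Set.univ s] [ht : DefF Set.univ t] :
    DefF Set.univ fun v => ZFSet.prod (s v) (t v) :=
  DefF.comp₂ (f := ZFSet.prod)
    (DefF.of_mem_iff (inferInstance : DefP Set.univ fun v => ∃ a, a ∈ v 1 ∧ ∃ b, b ∈ v 2 ∧
      v 0 = ZFSet.pair a b) fun v => by simp [tail]) hs ht

/-- The finite von Neumann ordinals. -/
def nat : ℕ → ZFSet.{u}
  | 0 => ∅
  | n + 1 => insert (nat n) (nat n)

instance defF_nat : ∀ n : ℕ, DefF Set.univ fun _ : Val.{u} => nat.{u} n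
  | 0 => defF_empty
  | n + 1 =>
    have := defF_nat n
    (inferInstance : DefF Set.univ fun _ : Val.{u} => insert (nat.{u} n) (nat n))

theorem nat_eq_toZFSet (n : ℕ) : nat.{u} n = Ordinal.toZFSet (n : Ordinal.{u}) := by
  induction n with
  | zero => simp [nat]
  | succ n ih => rw [nat, ih, Nat.cast_succ, Ordinal.toZFSet_add_one]

theorem nat_inj {m n : ℕ} : nat.{u} m = nat n ↔ m = n := by
  rw [nat_eq_toZFSet, nat_eq_toZFSet, Ordinal.toZFSet_injective.eq_iff, Nat.cast_inj]

theorem mem_omega_iff {x : ZFSet.{u}} : x ∈ omega ↔ ∃ n, x = nat n := by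
  have key : ∀ n, ZFSet.mk (PSet.ofNat.{u} n) = nat n := by
    intro n
    induction n with
    | zero => rfl
    | succ n ih => rw [nat, ← ih]; rfl
  constructor
  · refine Quotient.inductionOn x fun a => ?_
    rintro ⟨⟨n⟩, hn⟩
    exact ⟨n, (ZFSet.sound hn).trans (key n)⟩
  · rintro ⟨n, rfl⟩
    induction n with
    | zero => exact omega_zero
    | succ n ih => exact omega_succ ih

theorem nat_mem_omega (n : ℕ) : nat.{u} n ∈ omega := mem_omega_iff.2 ⟨n, rfl⟩

instance defF_omega : DefF Set.univ fun _ : Val.{u} => (ZFSet.omega : ZFSet.{u}) :=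
  DefF.of_mem_iff (inferInstance : DefP Set.univ fun v => ∀ z, ∅ ∈ z →
    (∀ y, y ∈ z → insert y y ∈ z) → v 0 ∈ z) fun v => by
    constructor
    · exact fun h => h _ omega_zero fun y hy => omega_succ hy
    · intro h z h0 hs
      obtain ⟨n, hn⟩ := mem_omega_iff.1 h
      rw [hn]
      clear hn h
      induction n with
      | zero => exact h0
      | succ n ih => exact hs _ ih

instance defF_funs [hs : DefF Set.univ s] [ht : DefF Set.univ t] :
    DefF Set.univ fun v => ZFSet.funs (s v) (t v) :=
  DefF.comp₂ (f := ZFSet.funs)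
    (DefF.of_mem_iff (inferInstance : DefP Set.univ fun v => v 0 ⊆ ZFSet.prod (v 1) (v 2) ∧
      ∀ z, z ∈ v 1 → ∃ w, ZFSet.pair z w ∈ v 0 ∧ ∀ y, ZFSet.pair z y ∈ v 0 → y = w)
      fun v => by simp only [tail, mem_funs, IsFunc, ExistsUnique]) hs ht

instance defP_isTransitive [hs : DefF Set.univ s] :
    DefP Set.univ fun v => ZFSet.IsTransitive (s v) :=
  DefP.comp₁ (R := ZFSet.IsTransitive)
    (inferInstance : DefP Set.univ fun v => ∀ y, y ∈ v 0 → y ⊆ v 0) hs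

instance defP_zOrd [hs : DefF Set.univ s] : DefP Set.univ fun v => ZOrd (s v) :=
  DefP.comp₁ (R := ZOrd)
    (inferInstance : DefP Set.univ fun v => (v 0).IsTransitive ∧ ∀ y, y ∈ v 0 → y.IsTransitive) hs

/-- The set with extension `Q`, if there is one, and `∅` otherwise. -/
noncomputable def cls (Q : ZFSet.{u} → Prop) : ZFSet.{u} :=
  open Classical in if h : ∃ y : ZFSet.{u}, ∀ w, w ∈ y ↔ Q w then h.choose else ∅

theorem mem_cls {Q : ZFSet.{u} → Prop} (h : ∃ y : ZFSet.{u}, ∀ w, Q w → w ∈ y) {w : ZFSet.{u}} :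
    w ∈ cls Q ↔ Q w := by
  have h' : ∃ y : ZFSet.{u}, ∀ w, w ∈ y ↔ Q w := by
    obtain ⟨y, hy⟩ := h
    exact ⟨y.sep Q, fun w => by rw [ZFSet.mem_sep]; exact ⟨And.right, fun hw => ⟨hy w hw, hw⟩⟩⟩
  rw [cls, dif_pos h']
  exact h'.choose_spec w

theorem cls_eq {Q : ZFSet.{u} → Prop} {x : ZFSet.{u}} (h : ∀ w, Q w ↔ w ∈ x) : cls Q = x := by
  ext w
  rw [mem_cls ⟨x, fun w => (h w).1⟩, h]

instance defF_cls {Q : Val.{u} → ZFSet.{u} → Prop}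
    [h : DefP Set.univ fun v => Q (tail v) (v 0)] :
    DefF Set.univ fun v => cls (Q v) := by
  have h₁ : DefP Set.univ fun v => Q (tail (tail (tail v))) (v 0) :=
    h.rename fun v => cons (v 0) (tail (tail (tail v)))
  refine DefF.of_mem_iff (inferInstance : DefP Set.univ fun v =>
    ∃ y : ZFSet.{u}, v 0 ∈ y ∧ ∀ w, w ∈ y ↔ Q (tail v) w) fun v => ?_
  constructor
  · rintro ⟨y, hv, hy⟩
    rwa [cls_eq fun w => (hy w).symm]
  · intro hv
    by_cases e : ∃ y : ZFSet.{u}, ∀ w, w ∈ y ↔ Q (tail v) w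
    · obtain ⟨y, hy⟩ := e
      rw [cls_eq fun w => (hy w).symm] at hv
      exact ⟨y, hv, hy⟩
    · rw [cls, dif_neg e] at hv
      exact absurd hv (notMem_empty _)

/-! ### Ordinals -/

theorem zOrd_iff {x : ZFSet.{u}} : ZOrd x ↔ x.IsOrdinal :=
  isOrdinal_iff_forall_mem_isTransitive.symm

theorem ZOrd_of_mem {x y : ZFSet.{u}} (hx : ZOrd x) (hy : y ∈ x) : ZOrd y :=
  zOrd_iff.2 ((zOrd_iff.1 hx).mem hy)

theorem zOrd_toZFSet (o : Ordinal.{u}) : ZOrd o.toZFSet := zOrd_iff.2 (isOrdinal_toZFSet o)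

theorem zOrd_empty : ZOrd (∅ : ZFSet.{u}) := zOrd_iff.2 isOrdinal_empty

theorem zOrd_nat (n : ℕ) : ZOrd (nat.{u} n) := nat_eq_toZFSet.{u} n ▸ zOrd_toZFSet _

/-- The least ordinal with property `Q`, or `∅` if there is none. -/
noncomputable def least (Q : ZFSet.{u} → Prop) : ZFSet.{u} :=
  cls fun w => ∃ x, ZOrd x ∧ Q x ∧ (∀ y, y ∈ x → ¬ Q y) ∧ w ∈ x

instance defF_least {Q : Val.{u} → ZFSet.{u} → Prop}
    [h : DefP Set.univ fun v => Q (tail v) (v 0)] :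
    DefF Set.univ fun v => least (Q v) := by
  have h₁ : DefP Set.univ fun v => Q (tail (tail v)) (v 0) :=
    h.rename fun v => cons (v 0) (tail (tail v))
  have h₂ : DefP Set.univ fun v => Q (tail (tail (tail v))) (v 0) :=
    h.rename fun v => cons (v 0) (tail (tail (tail v)))
  unfold least
  infer_instance

theorem least_spec {Q : ZFSet.{u} → Prop} (h : ∃ x, ZOrd x ∧ Q x) :
    ZOrd (least Q) ∧ Q (least Q) ∧ ∀ y ∈ least Q, ¬ Q y := by
  obtain ⟨x, ⟨hx, hQ⟩, hm⟩ := mem_wf.has_min {x | ZOrd x ∧ Q x} h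
  have hm' : ∀ y ∈ x, ¬ Q y := fun y hy hq => hm y ⟨ZOrd_of_mem hx hy, hq⟩ hy
  have : least Q = x := cls_eq fun w => by
    constructor
    · rintro ⟨y, hy, hQy, hmy, hw⟩
      rcases (zOrd_iff.1 hx).mem_trichotomous (zOrd_iff.1 hy) with h | h | h
      · exact absurd hQ (hmy _ h)
      · rwa [h]
      · exact absurd hQy (hm' _ h)
    · exact fun hw => ⟨x, hx, hQ, hm', hw⟩
  rw [this]
  exact ⟨hx, hQ, hm'⟩

theorem least_subset {Q : ZFSet.{u} → Prop} {x : ZFSet.{u}} (hx : ZOrd x) (hQ : Q x) :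
    least Q ⊆ x := by
  obtain ⟨h₁, -, h₃⟩ := least_spec ⟨x, hx, hQ⟩
  exact ((zOrd_iff.1 hx).notMem_iff_subset (zOrd_iff.1 h₁)).1 fun h => h₃ x h hQ

theorem zOrd_least (Q : ZFSet.{u} → Prop) : ZOrd (least Q) := by
  by_cases h : ∃ x, ZOrd x ∧ Q x
  · exact (least_spec h).1
  · rw [least, cls_eq (x := ∅)]
    · exact zOrd_empty
    · exact fun w => ⟨fun ⟨x, hx, hQ, _⟩ => (h ⟨x, hx, hQ⟩).elim,
        fun hw => (notMem_empty _ hw).elim⟩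

end

section

/-! ### Definability by recursion on membership -/

/-- The graph of `f` on the set `x`. -/
noncomputable def graph (f : ZFSet.{u} → ZFSet.{u}) (x : ZFSet.{u}) : ZFSet.{u} :=
  ZFSet.range fun z : x => pair z (f z)

theorem mem_graph {f : ZFSet.{u} → ZFSet.{u}} {x q : ZFSet.{u}} :
    q ∈ graph f x ↔ ∃ z ∈ x, q = pair z (f z) := by
  simp only [graph, mem_range, Subtype.exists, exists_prop]
  exact exists_congr fun z => and_congr_right fun _ => eq_comm

theorem pair_mem_graph {f : ZFSet.{u} → ZFSet.{u}} {x y z : ZFSet.{u}} :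
    pair z y ∈ graph f x ↔ z ∈ x ∧ y = f z := by
  rw [mem_graph]
  constructor
  · rintro ⟨w, hw, e⟩
    obtain ⟨rfl, rfl⟩ := pair_inj.1 e
    exact ⟨hw, rfl⟩
  · rintro ⟨hz, rfl⟩
    exact ⟨z, hz, rfl⟩

theorem defF_recursion {H F : ZFSet.{u} → ZFSet.{u} → ZFSet.{u}}
    (hH : DefF Set.univ fun v => H (v 0) (v 1)) (hF : ∀ a x, F a x = H a (graph (F a) x)) :
    DefF Set.univ fun v => F (v 0) (v 1) := by
  have hH' : ∀ s t : Val.{u} → ZFSet.{u}, ∀ [DefF Set.univ s] [DefF Set.univ t],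
      DefF Set.univ fun v => H (s v) (t v) := fun s t hs ht => hH.comp₂ hs ht
  refine DefF.of_mem_iff (R := fun v => ∃ f : ZFSet.{u}, (∀ z y, pair z y ∈ f →
      (∀ x, x ∈ z → ∃ w, pair x w ∈ f) ∧
      y = H (v 1) (cls fun q => q ∈ f ∧ ∃ x, x ∈ z ∧ ∃ w, q = pair x w)) ∧
      ∃ y, pair (v 2) y ∈ f ∧ v 0 ∈ y) inferInstance fun v => ?_
  constructor
  · rintro ⟨f, hf, y, hy, hv⟩
    have key : ∀ z y, pair z y ∈ f → y = F (v 1) z := by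
      intro z
      induction z using ZFSet.inductionOn with
      | _ z ih =>
      intro y hy
      obtain ⟨h₁, h₂⟩ := hf z y hy
      rw [h₂, hF]
      congr 1
      refine cls_eq fun q => ?_
      rw [mem_graph]
      constructor
      · rintro ⟨hq, x, hx, w, rfl⟩
        exact ⟨x, hx, by rw [ih x hx w hq]⟩
      · rintro ⟨x, hx, rfl⟩
        obtain ⟨w, hw⟩ := h₁ x hx
        rw [← ih x hx w hw]
        exact ⟨hw, x, hx, w, rfl⟩
    have := key _ _ hy
    rw [this] at hv
    exact hv
  · intro hv
    refine ⟨graph (F (v 1)) (vonNeumann (Order.succ (rank (v 2)))), fun z y h => ?_,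
      F (v 1) (v 2), pair_mem_graph.2 ⟨mem_vonNeumann_succ _, rfl⟩, hv⟩
    obtain ⟨hz, rfl⟩ := pair_mem_graph.1 h
    have ht : ∀ x ∈ z, x ∈ vonNeumann (Order.succ (rank (v 2))) := fun x hx =>
      (isTransitive_vonNeumann _).subset_of_mem hz hx
    refine ⟨fun x hx => ⟨_, pair_mem_graph.2 ⟨ht x hx, rfl⟩⟩, ?_⟩
    rw [hF]
    congr 1
    symm
    refine cls_eq fun q => ?_
    rw [mem_graph (x := z)]
    constructor
    · rintro ⟨hq, x, hx, w, rfl⟩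
      exact ⟨x, hx, by rw [(pair_mem_graph.1 hq).2]⟩
    · rintro ⟨x, hx, rfl⟩
      exact ⟨pair_mem_graph.2 ⟨ht x hx, rfl⟩, x, hx, _, rfl⟩

/-- The level of the cumulative hierarchy indexed by the rank of `x`. -/
noncomputable def level (x : ZFSet.{u}) : ZFSet.{u} := vonNeumann (rank x)

variable {q r s t : Val.{u} → ZFSet.{u}}

instance defF_level [hs : DefF Set.univ s] : DefF Set.univ fun v => level (s v) := by
  have : DefF Set.univ fun v : Val.{u} => level (v 1) := by
    refine defF_recursion (H := fun _ f => cls fun w => ∃ x y, pair x y ∈ f ∧ w ⊆ y)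
      (F := fun _ x => level x) inferInstance fun _ x => ?_
    symm
    refine cls_eq fun w => ?_
    simp only [pair_mem_graph, level, mem_vonNeumann, lt_rank_iff]
    constructor
    · rintro ⟨z, y, ⟨hz, rfl⟩, hw⟩
      exact ⟨z, hz, subset_vonNeumann.1 hw⟩
    · rintro ⟨z, hz, hw⟩
      exact ⟨z, _, ⟨hz, rfl⟩, subset_vonNeumann.2 hw⟩
  exact DefF.comp₂ (f := fun _ x => level x) this hs hs

/-! ### The operations generating the ordinal definable sets -/

/-- The assignments `s : ω → m` with `s i ∈ s j`. -/
noncomputable def memSet (m i j : ZFSet.{u}) : ZFSet.{u} :=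
  cls fun s => s ∈ funs omega m ∧ ∃ x y, pair i x ∈ s ∧ pair j y ∈ s ∧ x ∈ y

/-- The assignments `s : ω → m` with `s i = s j`. -/
noncomputable def eqSet (m i j : ZFSet.{u}) : ZFSet.{u} :=
  cls fun s => s ∈ funs omega m ∧ ∃ x, pair i x ∈ s ∧ pair j x ∈ s

/-- The assignments `s : ω → m` all of whose modifications at `i` belong to `b`. -/
noncomputable def allSet (m i b : ZFSet.{u}) : ZFSet.{u} :=
  cls fun s => s ∈ funs omega m ∧ ∀ x, x ∈ m → ∀ r, r ∈ funs omega m → pair i x ∈ r →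
    (∀ j, j ∈ omega → ¬ j = i → ∀ y, pair j y ∈ s → pair j y ∈ r) → r ∈ b

/-- The union of the sets `s 0` for `s ∈ b`. -/
noncomputable def valueSet (b : ZFSet.{u}) : ZFSet.{u} :=
  cls fun w => ∃ s, s ∈ b ∧ ∃ x, pair ∅ x ∈ s ∧ w ∈ x

instance [hr : DefF Set.univ r] [hs : DefF Set.univ s] [ht : DefF Set.univ t] :
    DefF Set.univ fun v => memSet (r v) (s v) (t v) :=
  DefF.comp₃ (f := memSet) (by unfold memSet; infer_instance) hr hs ht

instance [hr : DefF Set.univ r] [hs : DefF Set.univ s] [ht : DefF Set.univ t] :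
    DefF Set.univ fun v => eqSet (r v) (s v) (t v) :=
  DefF.comp₃ (f := eqSet) (by unfold eqSet; infer_instance) hr hs ht

instance [hr : DefF Set.univ r] [hs : DefF Set.univ s] [ht : DefF Set.univ t] :
    DefF Set.univ fun v => allSet (r v) (s v) (t v) :=
  DefF.comp₃ (f := allSet) (by unfold allSet; infer_instance) hr hs ht

instance [hs : DefF Set.univ s] : DefF Set.univ fun v => valueSet (s v) :=
  DefF.comp₁ (f := valueSet) (by unfold valueSet; infer_instance) hs

/-- A single operation, from which all ordinal definable sets can be generated: for `x = ∅` it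
yields ordinals and pairs, and for `x = pair (nat k) m` the operation number `k`, applied to
`m`, `o` and `y`. -/
noncomputable def op (a o x y : ZFSet.{u}) : ZFSet.{u} :=
  cls fun w => (x = ∅ ∧ y = ∅ ∧ w ∈ o) ∨ (x = ∅ ∧ ¬ y = ∅ ∧ w ∈ pair o y) ∨ ∃ m,
    (x = pair (nat 0) m ∧ w ∈ level o) ∨ (x = pair (nat 1) m ∧ w ∈ a) ∨
    (x = pair (nat 2) m ∧ w ∈ memSet m o y) ∨ (x = pair (nat 3) m ∧ w ∈ eqSet m o y) ∨
    (x = pair (nat 4) m ∧ w ∈ allSet m o y) ∨ (x = pair (nat 5) m ∧ w ∈ m ∧ ¬ w ∈ y) ∨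
    (x = pair (nat 6) m ∧ w ∈ m ∧ pair o y ∈ w) ∨ (x = pair (nat 7) m ∧ w ∈ valueSet m)

set_option synthInstance.maxHeartbeats 400000 in
set_option synthInstance.maxSize 2000 in
instance [hq : DefF Set.univ q] [hr : DefF Set.univ r] [hs : DefF Set.univ s]
    [ht : DefF Set.univ t] : DefF Set.univ fun v => op (q v) (r v) (s v) (t v) :=
  DefF.comp₄ (f := op) (by unfold op; infer_instance) hq hr hs ht

theorem pair_ne_empty (x y : ZFSet.{u}) : pair x y ≠ ∅ := fun h => by
  have : ({x} : ZFSet.{u}) ∈ pair x y := by simp [pair]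
  exact notMem_empty _ (h ▸ this)

section op

variable (a o m y : ZFSet.{u})

theorem op_empty_empty : op a o ∅ ∅ = o :=
  cls_eq fun w => by simp [(pair_ne_empty _ _).symm]

theorem op_empty {y : ZFSet.{u}} (hy : y ≠ ∅) : op a o ∅ y = pair o y :=
  cls_eq fun w => by simp [(pair_ne_empty _ _).symm, hy]

theorem op_level : op a o (pair (nat 0) m) y = level o :=
  cls_eq fun w => by simp [pair_ne_empty, nat_inj]

theorem op_parameter : op a o (pair (nat 1) m) y = a :=
  cls_eq fun w => by simp [pair_ne_empty, nat_inj]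

theorem op_memSet : op a o (pair (nat 2) m) y = memSet m o y :=
  cls_eq fun w => by simp [pair_ne_empty, nat_inj]

theorem op_eqSet : op a o (pair (nat 3) m) y = eqSet m o y :=
  cls_eq fun w => by simp [pair_ne_empty, nat_inj]

theorem op_allSet : op a o (pair (nat 4) m) y = allSet m o y :=
  cls_eq fun w => by simp [pair_ne_empty, nat_inj]

theorem op_diff : op a o (pair (nat 5) m) y = m \ y :=
  cls_eq fun w => by simp [pair_ne_empty, nat_inj]

theorem op_restrict : op a o (pair (nat 6) m) y = m.sep fun s => pair o y ∈ s :=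
  cls_eq fun w => by simp [pair_ne_empty, nat_inj]

theorem op_valueSet : op a o (pair (nat 7) m) y = valueSet m :=
  cls_eq fun w => by simp [pair_ne_empty, nat_inj]

end op

/-! ### The enumeration of the closure under the operation -/

/-- The value at `z` of a function given as a set of pairs. -/
noncomputable def app (f z : ZFSet.{u}) : ZFSet.{u} :=
  cls fun w => ∃ y, pair z y ∈ f ∧ w ∈ y

instance [hs : DefF Set.univ s] [ht : DefF Set.univ t] :
    DefF Set.univ fun v => app (s v) (t v) :=
  DefF.comp₂ (f := app) (by unfold app; infer_instance) hs ht

theorem app_graph {f : ZFSet.{u} → ZFSet.{u}} {x z : ZFSet.{u}} (hz : z ∈ x) :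
    app (graph f x) z = f z :=
  cls_eq fun w => by simp [pair_mem_graph, hz]

/-- The operation with the given indices yields a set not listed by `f`. -/
def IsNew (a f o y z : ZFSet.{u}) : Prop :=
  ¬ ∃ x, pair x (op a o (app f y) (app f z)) ∈ f

/-- The least bound of a triple of indices yielding something new. -/
noncomputable def bound (a f : ZFSet.{u}) : ZFSet.{u} :=
  least fun d => ∃ o, o ∈ d ∧ ∃ y, y ∈ d ∧ ∃ z, z ∈ d ∧ IsNew a f o y z

/-- The first index of the chosen triple. -/
noncomputable def ind₀ (a f : ZFSet.{u}) : ZFSet.{u} :=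
  least fun o => o ∈ bound a f ∧ ∃ y, y ∈ bound a f ∧ ∃ z, z ∈ bound a f ∧ IsNew a f o y z

/-- The second index of the chosen triple. -/
noncomputable def ind₁ (a f : ZFSet.{u}) : ZFSet.{u} :=
  least fun y => y ∈ bound a f ∧ ∃ z, z ∈ bound a f ∧ IsNew a f (ind₀ a f) y z

/-- The third index of the chosen triple. -/
noncomputable def ind₂ (a f : ZFSet.{u}) : ZFSet.{u} :=
  least fun z => z ∈ bound a f ∧ IsNew a f (ind₀ a f) (ind₁ a f) z

/-- The next set to be listed after those listed by `f`. -/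
noncomputable def next (a f : ZFSet.{u}) : ZFSet.{u} :=
  op a (ind₀ a f) (app f (ind₁ a f)) (app f (ind₂ a f))

instance [hs : DefF Set.univ s] [ht : DefF Set.univ t] :
    DefF Set.univ fun v => bound (s v) (t v) :=
  DefF.comp₂ (f := bound) (by unfold bound IsNew; infer_instance) hs ht

instance [hs : DefF Set.univ s] [ht : DefF Set.univ t] :
    DefF Set.univ fun v => ind₀ (s v) (t v) :=
  DefF.comp₂ (f := ind₀) (by unfold ind₀ IsNew; infer_instance) hs ht

instance [hs : DefF Set.univ s] [ht : DefF Set.univ t] :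
    DefF Set.univ fun v => ind₁ (s v) (t v) :=
  DefF.comp₂ (f := ind₁) (by unfold ind₁ IsNew; infer_instance) hs ht

instance [hs : DefF Set.univ s] [ht : DefF Set.univ t] :
    DefF Set.univ fun v => ind₂ (s v) (t v) :=
  DefF.comp₂ (f := ind₂) (by unfold ind₂ IsNew; infer_instance) hs ht

/-- The enumeration of the sets ordinal definable from `a`. -/
noncomputable def enum (a : ZFSet.{u}) : ZFSet.{u} → ZFSet.{u} :=
  mem_wf.fix fun x ih => next a (ZFSet.range fun z : x => pair z (ih z z.2))

theorem enum_eq (a x : ZFSet.{u}) : enum a x = next a (graph (enum a) x) :=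
  mem_wf.fix_eq _ x

instance [hs : DefF Set.univ s] [ht : DefF Set.univ t] :
    DefF Set.univ fun v => enum (s v) (t v) :=
  DefF.comp₂ (f := enum) (defF_recursion (H := next) (by unfold next; infer_instance) enum_eq) hs ht

/-- The class listed by `enum a`. -/
def Listed (a x : ZFSet.{u}) : Prop := ∃ o, ZOrd o ∧ x = enum a o

instance [hs : DefF Set.univ s] [ht : DefF Set.univ t] :
    DefP Set.univ fun v => Listed (s v) (t v) :=
  DefP.comp₂ (R := Listed) (by unfold Listed; infer_instance) hs ht

theorem next_spec {a f : ZFSet.{u}}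
    (h : ∃ d, ZOrd d ∧ ∃ o ∈ d, ∃ y ∈ d, ∃ z ∈ d, IsNew a f o y z) :
    ind₀ a f ∈ bound a f ∧ ind₁ a f ∈ bound a f ∧ ind₂ a f ∈ bound a f ∧
      IsNew a f (ind₀ a f) (ind₁ a f) (ind₂ a f) := by
  obtain ⟨hb, ⟨o, ho, h₀⟩, -⟩ := least_spec h
  obtain ⟨-, ⟨hi₀, y, hy, h₁⟩, -⟩ := least_spec (Q := fun o => o ∈ bound a f ∧
    ∃ y, y ∈ bound a f ∧ ∃ z, z ∈ bound a f ∧ IsNew a f o y z) ⟨o, ZOrd_of_mem hb ho, ho, h₀⟩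
  obtain ⟨-, ⟨hi₁, z, hz, h₂⟩, -⟩ := least_spec (Q := fun y => y ∈ bound a f ∧
    ∃ z, z ∈ bound a f ∧ IsNew a f (ind₀ a f) y z) ⟨y, ZOrd_of_mem hb hy, hy, h₁⟩
  obtain ⟨-, ⟨hi₂, h₃⟩, -⟩ := least_spec (Q := fun z => z ∈ bound a f ∧
    IsNew a f (ind₀ a f) (ind₁ a f) z) ⟨z, ZOrd_of_mem hb hz, hz, h₂⟩
  exact ⟨hi₀, hi₁, hi₂, h₃⟩

theorem listed_op {a o x y : ZFSet.{u}} (ho : ZOrd o) (hx : Listed a x) (hy : Listed a y) :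
    Listed a (op a o x y) := by
  obtain ⟨b, hb, rfl⟩ := hx
  obtain ⟨c, hc, rfl⟩ := hy
  by_contra hn
  obtain ⟨d, hd⟩ : ∃ d : Ordinal.{u}, d = Order.succ (max o.rank (max b.rank c.rank)) := ⟨_, rfl⟩
  have hmem : ∀ x : ZFSet.{u}, ZOrd x → x.rank < d → x ∈ d.toZFSet := fun x hx h => by
    rw [← (zOrd_iff.1 hx).toZFSet_rank_eq]
    exact Ordinal.toZFSet_mem_toZFSet_iff.2 h
  have ho' := hmem o ho (by rw [hd, Order.lt_succ_iff]; simp)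
  have hb' := hmem b hb (by rw [hd, Order.lt_succ_iff]; simp)
  have hc' := hmem c hc (by rw [hd, Order.lt_succ_iff]; simp)
  -- from stage `d` on, only new values of `op` at triples of indices below `d` are listed
  have key : ∀ e : Ordinal.{u}, d ≤ e → (∃ p : d.toZFSet × d.toZFSet × d.toZFSet,
      enum a e.toZFSet = op a p.1 (enum a p.2.1) (enum a p.2.2)) ∧
      ∀ e' < e, enum a e.toZFSet ≠ enum a e'.toZFSet := by
    intro e he
    have hde : ∀ x ∈ d.toZFSet, x ∈ e.toZFSet := Ordinal.toZFSet_subset_toZFSet_iff.2 he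
    have hnew : IsNew a (graph (enum a) e.toZFSet) o b c := by
      rintro ⟨x, hx⟩
      rw [pair_mem_graph, app_graph (hde _ hb'), app_graph (hde _ hc')] at hx
      exact hn ⟨x, ZOrd_of_mem (zOrd_toZFSet e) hx.1, hx.2⟩
    have hex : ∃ o ∈ d.toZFSet, ∃ y ∈ d.toZFSet, ∃ z ∈ d.toZFSet,
      IsNew a (graph (enum a) e.toZFSet) o y z := ⟨o, ho', b, hb', c, hc', hnew⟩
    obtain ⟨h₀, h₁, h₂, h₃⟩ := next_spec ⟨_, zOrd_toZFSet d, hex⟩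
    have hsub := least_subset (Q := fun d => ∃ o, o ∈ d ∧ ∃ y, y ∈ d ∧ ∃ z, z ∈ d ∧
      IsNew a (graph (enum a) e.toZFSet) o y z) (zOrd_toZFSet d) hex
    refine ⟨⟨⟨⟨_, hsub h₀⟩, ⟨_, hsub h₁⟩, ⟨_, hsub h₂⟩⟩, ?_⟩, fun e' he' h => ?_⟩
    · rw [enum_eq, next, app_graph (hde _ (hsub h₁)), app_graph (hde _ (hsub h₂))]
    · refine h₃ ⟨e'.toZFSet, pair_mem_graph.2 ⟨Ordinal.toZFSet_mem_toZFSet_iff.2 he', ?_⟩⟩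
      rw [← h, enum_eq, next]
  choose g hg using fun e : Ordinal.{u} => (key (d + e) (by simp)).1
  refine not_injective_of_ordinal g fun e₁ e₂ h => ?_
  have he : enum a (d + e₁).toZFSet = enum a (d + e₂).toZFSet := by rw [hg, hg, h]
  rcases lt_trichotomy e₁ e₂ with hlt | heq | hlt
  · exact ((key (d + e₂) (by simp)).2 (d + e₁) (by simpa using hlt) he.symm).elim
  · exact heq
  · exact ((key (d + e₁) (by simp)).2 (d + e₂) (by simpa using hlt) he).elim

theorem listed_empty (a : ZFSet.{u}) : Listed a ∅ := by
  refine ⟨∅, zOrd_empty, ?_⟩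
  have happ : ∀ z, app (graph (enum a) ∅) z = ∅ := fun z =>
    cls_eq fun w => by simp [pair_mem_graph]
  have hnew : ∀ o y z, IsNew a (graph (enum a) ∅) o y z := fun o y z => by
    simp [IsNew, pair_mem_graph]
  have h1 : (∅ : ZFSet.{u}) ∈ nat 1 := by simp [nat]
  obtain ⟨h₀, -⟩ := next_spec ⟨nat 1, zOrd_nat 1, ∅, h1, ∅, h1, ∅, h1, hnew _ _ _⟩
  have hb : ∅ ∈ bound a (graph (enum a) ∅) := by
    by_contra hb
    have := ((zOrd_iff.1 zOrd_empty).notMem_iff_subset (zOrd_iff.1 (zOrd_least _))).1 hb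
    exact notMem_empty _ (this h₀)
  have hi : ind₀ a (graph (enum a) ∅) = ∅ := by
    refine (eq_empty _).2 fun y hy => notMem_empty y ?_
    exact least_subset (Q := fun o => o ∈ bound a (graph (enum a) ∅) ∧
      ∃ y, y ∈ bound a (graph (enum a) ∅) ∧ ∃ z, z ∈ bound a (graph (enum a) ∅) ∧
      IsNew a (graph (enum a) ∅) o y z) zOrd_empty ⟨hb, ∅, hb, ∅, hb, hnew _ _ _⟩ hy
  rw [enum_eq, next, happ, happ, hi, op_empty_empty]

theorem listed_ord (a : ZFSet.{u}) {o : ZFSet.{u}} (ho : ZOrd o) : Listed a o := by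
  have := listed_op ho (listed_empty a) (listed_empty a)
  rwa [op_empty_empty] at this

theorem listed_pair {a o y : ZFSet.{u}} (ho : ZOrd o) (hy : Listed a y) (h : y ≠ ∅) :
    Listed a (pair o y) := by
  have := listed_op ho (listed_empty a) hy
  rwa [op_empty a o h] at this

end

/-! ### Reflection -/

theorem exists_witness_bound (b : Ordinal.{u}) : ∃ c : Ordinal.{u}, ∀ (φ : Fml) (n : ℕ)
    (v : Val.{u}), (∀ m, v m ∈ vonNeumann b) →
    (∃ x, ¬ FmlSat Set.univ φ (Function.update v n x)) →
    ∃ x ∈ vonNeumann c, ¬ FmlSat Set.univ φ (Function.update v n x) := by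
  classical
  let w : Fml × ℕ × (ℕ → vonNeumann b) → ZFSet.{u} := fun p =>
    if h : ∃ x, ¬ FmlSat Set.univ p.1 (Function.update (fun m => (p.2.2 m : ZFSet.{u})) p.2.1 x)
    then h.choose else ∅
  refine ⟨⨆ p, Order.succ (rank (w p)), fun φ n v hv h => ?_⟩
  let p : Fml × ℕ × (ℕ → vonNeumann b) := (φ, n, fun m => ⟨v m, hv m⟩)
  refine ⟨w p, ?_, ?_⟩
  · rw [mem_vonNeumann]
    exact (Order.lt_succ _).trans_le (Ordinal.le_iSup (fun p => Order.succ (rank (w p))) p)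
  · have e : w p = h.choose := dif_pos h
    rw [e]
    exact h.choose_spec

theorem exists_reflecting (b : Ordinal.{u}) : ∃ c, b < c ∧ ∀ (φ : Fml) (v : Val.{u}),
    (∀ n, v n ∈ vonNeumann c) →
    (FmlSat {x | x ∈ vonNeumann c} φ v ↔ FmlSat Set.univ φ v) := by
  choose g hg using exists_witness_bound.{u}
  let f : ℕ → Ordinal.{u} := fun n => Nat.rec (Order.succ b) (fun _ c => max (Order.succ c) (g c)) n
  have hf : ∀ n, f n < f (n + 1) := fun n => (Order.lt_succ _).trans_le (le_max_left _ _)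
  have hmono : Monotone f := monotone_nat_of_le_succ fun n => (hf n).le
  have hlt : ∀ n, f n < ⨆ n, f n := fun n => (hf n).trans_le (Ordinal.le_iSup f (n + 1))
  refine ⟨⨆ n, f n, (Order.lt_succ b).trans_le (Ordinal.le_iSup f 0), fun φ => ?_⟩
  induction φ with
  | mem i j => exact fun v _ => Iff.rfl
  | eq i j => exact fun v _ => Iff.rfl
  | impl φ ψ ih₁ ih₂ => exact fun v hv => imp_congr (ih₁ v hv) (ih₂ v hv)
  | not φ ih => exact fun v hv => not_congr (ih v hv)
  | all n φ ih =>
    intro v hv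
    have hupd : ∀ x ∈ vonNeumann (⨆ n, f n), ∀ m,
        Function.update v n x m ∈ vonNeumann (⨆ n, f n) := fun x hx m => by
      by_cases e : m = n
      · subst e; simpa using hx
      · simpa [Function.update_of_ne e] using hv m
    constructor
    · intro h x _
      by_contra hx
      have hk : ∃ k, ∀ m < bd φ, v m ∈ vonNeumann (f k) := by
        have : ∀ m, ∃ k, v m ∈ vonNeumann (f k) := fun m => by
          have := hv m
          rw [mem_vonNeumann, Ordinal.lt_iSup_iff] at this
          obtain ⟨k, hk⟩ := this
          exact ⟨k, mem_vonNeumann.2 hk⟩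
        choose k hk using this
        refine ⟨(Finset.range (bd φ)).sup k, fun m hm => ?_⟩
        have hle : k m ≤ (Finset.range (bd φ)).sup k :=
          Finset.le_sup (f := k) (Finset.mem_range.2 hm)
        rw [mem_vonNeumann]
        exact (mem_vonNeumann.1 (hk m)).trans_le (hmono hle)
      obtain ⟨k, hk⟩ := hk
      have hcongr : ∀ y, FmlSat Set.univ φ (Function.update v n y) ↔
          FmlSat Set.univ φ (Function.update (fun m => if m < bd φ then v m else ∅) n y) :=
        fun y => sat_congr _ _ _ _ fun m hm => by
          by_cases e : m = n
          · subst e; simp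
          · simp [Function.update_of_ne e, hm]
      have hempty : ∅ ∈ vonNeumann (f k) := by
        rw [mem_vonNeumann, rank_empty]
        exact (zero_le (a := b)).trans_lt ((Order.lt_succ b).trans_le (hmono (Nat.zero_le k)))
      obtain ⟨y, hy, hy'⟩ := hg (f k) φ n (fun m => if m < bd φ then v m else ∅)
        (fun m => by split_ifs with hm; exacts [hk m hm, hempty])
        ⟨x, fun h => hx ((hcongr x).2 h)⟩
      have hy₂ : y ∈ vonNeumann (⨆ n, f n) := mem_vonNeumann.2
        ((mem_vonNeumann.1 hy).trans_le ((le_max_right _ _).trans (Ordinal.le_iSup f (k + 1))))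
      exact hy' ((hcongr y).1 ((ih _ (hupd y hy₂)).1 (h y hy₂)))
    · exact fun h x hx => (ih _ (hupd x hx)).2 (h x trivial)

/-! ### Coded assignments -/

/-- An assignment, coded as a function on `ω`. -/
noncomputable def enc (v : Val.{u}) : ZFSet.{u} :=
  ZFSet.range fun n : ℕ => pair (nat n) (v n)

theorem mem_enc {v : Val.{u}} {q : ZFSet.{u}} : q ∈ enc v ↔ ∃ n, q = pair (nat n) (v n) := by
  simp only [enc, mem_range]
  exact exists_congr fun n => eq_comm

theorem pair_mem_enc {v : Val.{u}} {n : ℕ} {y : ZFSet.{u}} : pair (nat n) y ∈ enc v ↔ y = v n := by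
  rw [mem_enc]
  constructor
  · rintro ⟨m, h⟩
    obtain ⟨h₁, h₂⟩ := pair_inj.1 h
    rw [h₂, nat_inj.1 h₁]
  · rintro rfl
    exact ⟨n, rfl⟩

theorem enc_injective {v w : Val.{u}} (h : enc v = enc w) : v = w :=
  funext fun _ => pair_mem_enc.1 (h ▸ pair_mem_enc.2 rfl)

theorem mem_funs_omega {m s : ZFSet.{u}} :
    s ∈ funs omega m ↔ ∃ v : Val.{u}, (∀ n, v n ∈ m) ∧ s = enc v := by
  rw [mem_funs]
  constructor
  · rintro ⟨h₁, h₂⟩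
    choose v hv hv' using fun n : ℕ => h₂ (nat n) (nat_mem_omega n)
    refine ⟨v, fun n => (pair_mem_prod.1 (h₁ (hv n))).2, ?_⟩
    ext q
    rw [mem_enc]
    constructor
    · intro hq
      obtain ⟨x, hx, y, hy, rfl⟩ := mem_prod.1 (h₁ hq)
      obtain ⟨n, rfl⟩ := mem_omega_iff.1 hx
      exact ⟨n, by rw [hv' n y hq]⟩
    · rintro ⟨n, rfl⟩
      exact hv n
  · rintro ⟨v, hv, rfl⟩
    refine ⟨fun q hq => ?_, fun z hz => ?_⟩
    · obtain ⟨n, rfl⟩ := mem_enc.1 hq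
      exact pair_mem_prod.2 ⟨nat_mem_omega n, hv n⟩
    · obtain ⟨n, rfl⟩ := mem_omega_iff.1 hz
      exact ⟨v n, pair_mem_enc.2 rfl, fun y hy => pair_mem_enc.1 hy⟩

/-- The coded assignments in `m` with property `R`. -/
noncomputable def asgSet (m : ZFSet.{u}) (R : Val.{u} → Prop) : ZFSet.{u} :=
  cls fun s => ∃ v : Val.{u}, (∀ n, v n ∈ m) ∧ s = enc v ∧ R v

theorem mem_asgSet {m s : ZFSet.{u}} {R : Val.{u} → Prop} :
    s ∈ asgSet m R ↔ ∃ v : Val.{u}, (∀ n, v n ∈ m) ∧ s = enc v ∧ R v :=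
  mem_cls ⟨funs omega m, fun _ ⟨v, hv, e, _⟩ => mem_funs_omega.2 ⟨v, hv, e⟩⟩

theorem enc_mem_asgSet {m : ZFSet.{u}} {R : Val.{u} → Prop} {v : Val.{u}} :
    enc v ∈ asgSet m R ↔ (∀ n, v n ∈ m) ∧ R v := by
  rw [mem_asgSet]
  constructor
  · rintro ⟨w, hw, e, h⟩
    rw [enc_injective e]
    exact ⟨hw, h⟩
  · exact fun h => ⟨v, h.1, rfl, h.2⟩

theorem ext_asg {m x y : ZFSet.{u}} (hx : x ⊆ funs omega m) (hy : y ⊆ funs omega m)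
    (h : ∀ v : Val.{u}, (∀ n, v n ∈ m) → (enc v ∈ x ↔ enc v ∈ y)) : x = y := by
  ext s
  constructor
  · intro hs
    obtain ⟨v, hv, rfl⟩ := mem_funs_omega.1 (hx hs)
    exact (h v hv).1 hs
  · intro hs
    obtain ⟨v, hv, rfl⟩ := mem_funs_omega.1 (hy hs)
    exact (h v hv).2 hs

theorem asgSet_subset (m : ZFSet.{u}) (R : Val.{u} → Prop) : asgSet m R ⊆ funs omega m := by
  intro s hs
  obtain ⟨v, hv, e, -⟩ := mem_asgSet.1 hs
  exact mem_funs_omega.2 ⟨v, hv, e⟩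

theorem memSet_eq (m : ZFSet.{u}) (i j : ℕ) :
    memSet m (nat i) (nat j) = asgSet m fun v => v i ∈ v j := by
  refine cls_eq fun s => ?_
  rw [mem_asgSet, mem_funs_omega]
  constructor
  · rintro ⟨⟨v, hv, rfl⟩, x, y, hx, hy, h⟩
    rw [pair_mem_enc] at hx hy
    exact ⟨v, hv, rfl, hx ▸ hy ▸ h⟩
  · rintro ⟨v, hv, rfl, h⟩
    exact ⟨⟨v, hv, rfl⟩, _, _, pair_mem_enc.2 rfl, pair_mem_enc.2 rfl, h⟩

theorem eqSet_eq (m : ZFSet.{u}) (i j : ℕ) :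
    eqSet m (nat i) (nat j) = asgSet m fun v => v i = v j := by
  refine cls_eq fun s => ?_
  rw [mem_asgSet, mem_funs_omega]
  constructor
  · rintro ⟨⟨v, hv, rfl⟩, x, hx, hy⟩
    rw [pair_mem_enc] at hx hy
    exact ⟨v, hv, rfl, hx ▸ hy⟩
  · rintro ⟨v, hv, rfl, h⟩
    exact ⟨⟨v, hv, rfl⟩, _, pair_mem_enc.2 rfl, pair_mem_enc.2 h⟩

theorem allSet_eq (m : ZFSet.{u}) (i : ℕ) (R : Val.{u} → Prop) :
    allSet m (nat i) (asgSet m R) = asgSet m fun v => ∀ x ∈ m, R (Function.update v i x) := by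
  refine cls_eq fun s => ?_
  rw [mem_asgSet, mem_funs_omega]
  constructor
  · rintro ⟨⟨v, hv, rfl⟩, h⟩
    refine ⟨v, hv, rfl, fun x hx => ?_⟩
    have hupd : ∀ n, Function.update v i x n ∈ m := fun n => by
      by_cases e : n = i
      · subst e; simpa using hx
      · simpa [Function.update_of_ne e] using hv n
    refine (enc_mem_asgSet.1 (h x hx (enc (Function.update v i x))
      (mem_funs_omega.2 ⟨_, hupd, rfl⟩) (pair_mem_enc.2 (by simp)) ?_)).2
    intro j hj hji y hy
    obtain ⟨n, rfl⟩ := mem_omega_iff.1 hj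
    have e : n ≠ i := fun e => hji (by rw [e])
    rw [pair_mem_enc] at hy ⊢
    rw [hy, Function.update_of_ne e]
  · rintro ⟨v, hv, rfl, h⟩
    refine ⟨⟨v, hv, rfl⟩, fun x hx r hr hix hj => ?_⟩
    obtain ⟨w, hw, rfl⟩ := mem_funs_omega.1 hr
    have : w = Function.update v i x := by
      funext n
      by_cases e : n = i
      · subst e; simpa using (pair_mem_enc.1 hix).symm
      · rw [Function.update_of_ne e]
        exact (pair_mem_enc.1 (hj (nat n) (nat_mem_omega n) (fun h => e (nat_inj.1 h)) (v n)
          (pair_mem_enc.2 rfl))).symm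
    rw [enc_mem_asgSet]
    exact ⟨hw, this ▸ h x hx⟩

/-! ### Every ordinal definable set is listed -/

section listed

variable {a : ZFSet.{u}}

theorem nat_one_ne_empty : nat.{u} 1 ≠ ∅ := fun h => by
  have : (∅ : ZFSet.{u}) ∈ nat 1 := by simp [nat]
  exact notMem_empty _ (h ▸ this)

theorem listed_level {o : ZFSet.{u}} (ho : ZOrd o) : Listed a (level o) := by
  have h := listed_op ho (listed_pair (zOrd_nat 0) (listed_ord a (zOrd_nat 1)) nat_one_ne_empty)
    (listed_empty a)
  rwa [op_level] at h

theorem listed_parameter : Listed a a := by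
  have h := listed_op (zOrd_nat 0)
    (listed_pair (zOrd_nat 1) (listed_ord a (zOrd_nat 1)) nat_one_ne_empty) (listed_empty a)
  rwa [op_parameter] at h

theorem listed_diff {x y : ZFSet.{u}} (hx : Listed a x) (hy : Listed a y) : Listed a (x \ y) := by
  by_cases e : x = ∅
  · have : x \ y = ∅ := (eq_empty _).2 fun z hz => by simp [e] at hz
    rw [this]
    exact listed_empty a
  · have h := listed_op (zOrd_nat 0) (listed_pair (zOrd_nat 5) hx e) hy
    rwa [op_diff] at h

theorem listed_restrict {o x y : ZFSet.{u}} (ho : ZOrd o) (hx : Listed a x) (hy : Listed a y) :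
    Listed a (x.sep fun s => pair o y ∈ s) := by
  by_cases e : x = ∅
  · have : (x.sep fun s => pair o y ∈ s) = ∅ := (eq_empty _).2 fun z hz => by simp [e] at hz
    rw [this]
    exact listed_empty a
  · have h := listed_op ho (listed_pair (zOrd_nat 6) hx e) hy
    rwa [op_restrict] at h

theorem listed_asgSet {m : ZFSet.{u}} (hm : Listed a m) (hne : m ≠ ∅) (φ : Fml) :
    Listed a (asgSet m (FmlSat {x | x ∈ m} φ)) := by
  have hall : Listed a (asgSet m fun _ => True) := by
    have h := listed_op (zOrd_nat 0) (listed_pair (zOrd_nat 3) hm hne) (listed_ord a (zOrd_nat 0))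
    rw [op_eqSet, eqSet_eq] at h
    simpa using h
  induction φ with
  | mem i j =>
    have h := listed_op (zOrd_nat i) (listed_pair (zOrd_nat 2) hm hne) (listed_ord a (zOrd_nat j))
    rwa [op_memSet, memSet_eq] at h
  | eq i j =>
    have h := listed_op (zOrd_nat i) (listed_pair (zOrd_nat 3) hm hne) (listed_ord a (zOrd_nat j))
    rwa [op_eqSet, eqSet_eq] at h
  | impl φ ψ ih₁ ih₂ =>
    have h := listed_diff hall (listed_diff ih₁ ih₂)
    have hs : ∀ x : ZFSet.{u}, asgSet m (fun _ => True) \ x ⊆ funs omega m :=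
      fun x s hs => asgSet_subset _ _ (ZFSet.mem_sdiff.1 hs).1
    rwa [ext_asg (hs _) (asgSet_subset m (FmlSat {x | x ∈ m} (.impl φ ψ))) fun v hv => ?_] at h
    simp only [ZFSet.mem_sdiff, enc_mem_asgSet, FmlSat]
    tauto
  | not φ ih =>
    have h := listed_diff hall ih
    have hs : ∀ x : ZFSet.{u}, asgSet m (fun _ => True) \ x ⊆ funs omega m :=
      fun x s hs => asgSet_subset _ _ (ZFSet.mem_sdiff.1 hs).1
    rwa [ext_asg (hs _) (asgSet_subset m (FmlSat {x | x ∈ m} (.not φ))) fun v hv => ?_] at h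
    simp only [ZFSet.mem_sdiff, enc_mem_asgSet, FmlSat]
    tauto
  | all n φ ih =>
    have h := listed_op (zOrd_nat n) (listed_pair (zOrd_nat 4) hm hne) ih
    rwa [op_allSet, allSet_eq] at h

theorem listed_of_zODp {x : ZFSet.{u}} (h : ZODp a x) : Listed a x := by
  obtain ⟨φ, v, hv, hx⟩ := h
  obtain ⟨c, hc, hrefl⟩ := exists_reflecting (max (rank x) (⨆ n, rank (v n)))
  obtain ⟨M, hM⟩ : ∃ M, M = vonNeumann c := ⟨_, rfl⟩
  have hxM : x ∈ M := by
    rw [hM, mem_vonNeumann]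
    exact (le_max_left _ _).trans_lt hc
  have hvM : ∀ n, v n ∈ M := fun n => by
    rw [hM, mem_vonNeumann]
    exact ((Ordinal.le_iSup (fun n => rank (v n)) n).trans (le_max_right _ _)).trans_lt hc
  rw [← hM] at hrefl
  have hupd : ∀ y ∈ M, ∀ n, Function.update v 0 y n ∈ M := fun y hy n => by
    by_cases e : n = 0
    · subst e; simpa using hy
    · simpa [Function.update_of_ne e] using hvM n
  have hML : Listed a M := by
    have h := listed_level (a := a) (zOrd_toZFSet c)
    rwa [level, Ordinal.rank_toZFSet, ← hM] at h
  have hlist : ∀ k, Listed a (asgSet M fun w => FmlSat {x | x ∈ M} φ w ∧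
      ∀ n < k, w (n + 1) = v (n + 1)) := by
    intro k
    induction k with
    | zero => simpa using listed_asgSet hML (fun e => notMem_empty x (e ▸ hxM)) φ
    | succ k ih =>
      have hvk : Listed a (v (k + 1)) := by
        rcases hv (k + 1) with h | h
        · exact listed_ord a h
        · rw [h]; exact listed_parameter
      have h := listed_restrict (zOrd_nat (k + 1)) ih hvk
      rwa [ext_asg (fun s hs => asgSet_subset _ _ (mem_sep.1 hs).1)
        (asgSet_subset M fun w => FmlSat {x | x ∈ M} φ w ∧ ∀ n < k + 1, w (n + 1) = v (n + 1))
        fun w hw => ?_] at h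
      simp only [mem_sep, enc_mem_asgSet, pair_mem_enc, Nat.lt_succ_iff_lt_or_eq, or_imp,
        forall_and, forall_eq]
      rw [eq_comm (a := v (k + 1))]
      tauto
  obtain ⟨D, hD⟩ : ∃ D, D = asgSet M fun w => FmlSat {x | x ∈ M} φ w ∧
      ∀ n < bd φ, w (n + 1) = v (n + 1) := ⟨_, rfl⟩
  have hxD : enc (Function.update v 0 x) ∈ D := by
    rw [hD, enc_mem_asgSet]
    exact ⟨hupd x hxM, (hrefl _ _ (hupd x hxM)).2 ((hx x).2 rfl), fun n _ => by simp⟩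
  have hval : valueSet D = x := by
    refine cls_eq fun w => ?_
    constructor
    · rintro ⟨s, hs, y, hy, hw⟩
      rw [hD, mem_asgSet] at hs
      obtain ⟨r, hr, rfl, h₁, h₂⟩ := hs
      have hy' : y = r 0 := pair_mem_enc (n := 0).1 hy
      have : y = x := by
        rw [← hx, ← hrefl _ _ (hupd y (hy' ▸ hr 0)),
          sat_congr _ _ _ r fun n hn => ?_]
        · exact h₁
        · rcases n with _ | n
          · simp [hy']
          · rw [Function.update_of_ne (by simp), h₂ n (by omega)]
      rwa [← this]
    · intro hw
      exact ⟨_, hxD, x, pair_mem_enc (n := 0).2 (by simp), hw⟩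
  have h := listed_op (zOrd_nat 0) (listed_pair (zOrd_nat 7) (hD ▸ hlist (bd φ))
    (fun e => notMem_empty _ (e ▸ hxD))) (listed_empty a)
  rwa [op_valueSet, hval] at h

end listed

/-! ### Closure properties of ordinal definability -/

/-- Change the value of an assignment at one variable. -/
def upd (v : Val.{u}) (n : ℕ) (x : ZFSet.{u}) : Val.{u} := Function.update v n x

instance isRenaming_upd (s t : Val.{u} → Val.{u}) [hs : IsRenaming s] [ht : IsRenaming t]
    (n i : ℕ) : IsRenaming (fun v => upd (s v) n (t v i)) :=
  let ⟨f, hf⟩ := hs.out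
  let ⟨g, hg⟩ := ht.out
  ⟨⟨fun m => if m = n then g i else f m, fun v m => by
    by_cases e : m = n
    · subst e; simp [upd, hg]
    · simp [upd, e, hf]⟩⟩

section

variable {a x : ZFSet.{u}}

theorem zODp_of_defP {R : Val.{u} → Prop} (hR : DefP Set.univ R) {v : Val.{u}}
    (hv : ∀ n, ZOrd (v n) ∨ v n = a) (h : ∀ y, R (cons y v) ↔ y = x) : ZODp a x := by
  obtain ⟨φ, hφ⟩ := hR.out
  refine ⟨φ, cons ∅ v, fun n => ?_, fun y => ?_⟩
  · cases n
    · exact Or.inl zOrd_empty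
    · exact hv _
  · have : Function.update (cons ∅ v) 0 y = cons y v := by
      funext n
      cases n <;> rfl
    rw [this, hφ _ fun _ => trivial, h]

theorem zODp_iff_listed : ZODp a x ↔ Listed a x := by
  refine ⟨listed_of_zODp, ?_⟩
  rintro ⟨o, ho, rfl⟩
  refine zODp_of_defP (R := fun w => w 0 = enum (w 1) (w 2)) inferInstance
    (v := cons a (cons o fun _ => ∅)) (fun n => ?_) fun y => Iff.rfl
  rcases n with _ | _ | n
  · exact Or.inr rfl
  · exact Or.inl ho
  · exact Or.inl zOrd_empty

open Classical in
theorem defP_enum_subst (φ : Fml) : ∀ J : Set ℕ, DefP Set.univ fun w : Val.{u} =>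
    FmlSat Set.univ φ fun n => if n ∈ J then enum (w 0) (w (n + 1)) else w (n + 1) := by
  have hF : ∀ (J : Set ℕ) (i : ℕ), DefF Set.univ fun w : Val.{u} =>
      if i ∈ J then enum (w 0) (w (i + 1)) else w (i + 1) := fun J i => by
    by_cases h : i ∈ J
    · simp only [h, if_true]; infer_instance
    · simp only [h, if_false]; infer_instance
  induction φ with
  | mem i j => exact fun J => DefP.mem
  | eq i j => exact fun J => DefP.eq
  | impl φ ψ ih₁ ih₂ => exact fun J => DefP.imp (h := ih₁ J) (h' := ih₂ J)
  | not φ ih => exact fun J => DefP.not (h := ih J)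
  | all n φ ih =>
    intro J
    obtain ⟨J', hJ'⟩ : ∃ J' : Set ℕ, ∀ m, m ∈ J' ↔ m ∈ J ∧ m ≠ n := ⟨_, fun _ => Iff.rfl⟩
    have := isRenaming_upd tail (fun w : Val.{u} => w) (n + 1) 0
    have h := (ih J').rename fun w : Val.{u} => upd (tail w) (n + 1) (w 0)
    refine (DefP.forall_mem_class (R := fun w x => FmlSat Set.univ φ fun m =>
      if m ∈ J' then enum (upd w (n + 1) x 0) (upd w (n + 1) x (m + 1))
      else upd w (n + 1) x (m + 1)) h).congr fun w _ => ?_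
    refine forall₂_congr fun x _ => iff_of_eq (congrArg _ (funext fun m => ?_))
    by_cases e : m = n
    · subst e; simp [upd, hJ']
    · simp [upd, hJ', e]

theorem listed_of_defP {R : Val.{u} → Prop} (hR : DefP Set.univ R) {v : Val.{u}}
    (hv : ∀ n, Listed a (v n)) (h : ∀ y, R (cons y v) ↔ y = x) : Listed a x := by
  obtain ⟨φ, hφ⟩ := hR.out
  choose o ho hvo using hv
  rw [← zODp_iff_listed]
  refine zODp_of_defP ((defP_enum_subst φ {n | n ≠ 0}).rename
    fun u => cons (u 1) (cons (u 0) (tail (tail u)))) (v := cons a o) (fun n => ?_) fun y => ?_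
  · cases n
    · exact Or.inr rfl
    · exact Or.inl (ho _)
  · rw [← h, ← hφ _ fun _ => trivial]
    refine iff_of_eq (congrArg _ (funext fun n => ?_))
    rcases n with _ | n
    · simp
    · simp [hvo n]

theorem listed_of_defF {t : Val.{u} → ZFSet.{u}} (ht : DefF Set.univ t) {v : Val.{u}}
    (hv : ∀ n, Listed a (v n)) : Listed a (t v) := by
  have := ht.rename tail
  exact listed_of_defP (R := fun w => w 0 = t (tail w)) inferInstance hv fun y => Iff.rfl

theorem listed_of_mem_iff {R : Val.{u} → Prop} (hR : DefP Set.univ R) {v : Val.{u}}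
    (hv : ∀ n, Listed a (v n)) (h : ∀ y, y ∈ x ↔ R (cons y v)) : Listed a x := by
  have h' := hR.rename fun w : Val.{u} => cons (w 0) (tail (tail w))
  refine listed_of_defP (R := fun w => ∀ y, y ∈ w 0 ↔ R (cons y (tail w))) inferInstance hv
    fun y => ?_
  rw [ZFSet.ext_iff]
  exact forall_congr' fun z => by rw [h]; rfl

/-! ### The class of sets hereditarily ordinal definable from a parameter -/

/-- The class of sets hereditarily ordinal definable from `a`. -/
def HP (a : ZFSet.{u}) : ZClass.{u} := {x | InHODp a x}

theorem mem_HP_iff : x ∈ HP a ↔ Listed a x ∧ ∀ y ∈ x, y ∈ HP a := by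
  rw [← zODp_iff_listed]
  exact ⟨fun ⟨_, h₁, h₂⟩ => ⟨h₁, h₂⟩, fun h => ⟨x, h.1, h.2⟩⟩

theorem classTransitive_HP (a : ZFSet.{u}) : ClassTransitive (HP a) :=
  fun _ hx => (mem_HP_iff.1 hx).2

theorem mem_HP_iff_exists :
    x ∈ HP a ↔ Listed a x ∧ ∃ t, x ⊆ t ∧ t.IsTransitive ∧ ∀ y, y ∈ t → Listed a y := by
  constructor
  · intro hx
    refine ⟨(mem_HP_iff.1 hx).1, (vonNeumann (rank x)).sep (· ∈ HP a), fun y hy => ?_,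
      fun y hy z hz => ?_, fun y hy => (mem_HP_iff.1 (mem_sep.1 hy).2).1⟩
    · exact mem_sep.2 ⟨mem_vonNeumann.2 (rank_lt_of_mem hy), classTransitive_HP a x hx y hy⟩
    · rw [mem_sep] at hy ⊢
      exact ⟨(isTransitive_vonNeumann _).subset_of_mem hy.1 hz, classTransitive_HP a y hy.2 z hz⟩
  · rintro ⟨hx, t, hxt, ht, htl⟩
    refine mem_HP_iff.2 ⟨hx, fun y hy => ?_⟩
    replace hy := hxt hy
    clear hx hxt
    induction y using ZFSet.inductionOn with
    | _ y ih => exact mem_HP_iff.2 ⟨htl y hy, fun z hz => ih z hz (ht.subset_of_mem hy hz)⟩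

instance {s t : Val.{u} → ZFSet.{u}} [hs : DefF Set.univ s] [ht : DefF Set.univ t] :
    DefP Set.univ fun v => t v ∈ HP (s v) :=
  DefP.comp₂ (R := fun a x => x ∈ HP a)
    ((inferInstance : DefP Set.univ fun v => Listed (v 0) (v 1) ∧
      ∃ t, v 1 ⊆ t ∧ t.IsTransitive ∧ ∀ y, y ∈ t → Listed (v 0) y).congr
      fun _ _ => mem_HP_iff_exists.symm) hs ht

theorem defP_sat_HP (φ : Fml) :
    DefP Set.univ fun w : Val.{u} => FmlSat (HP (w 0)) φ (tail w) := by
  induction φ with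
  | mem i j => exact (inferInstance : DefP Set.univ fun w : Val.{u} => tail w i ∈ tail w j)
  | eq i j => exact (inferInstance : DefP Set.univ fun w : Val.{u} => tail w i = tail w j)
  | impl φ ψ ih₁ ih₂ => exact DefP.imp
  | not φ ih => exact DefP.not
  | all n φ ih =>
    have := isRenaming_upd tail (fun w : Val.{u} => w) (n + 1) 0
    have h := ih.rename fun w : Val.{u} => upd (tail w) (n + 1) (w 0)
    refine (inferInstance : DefP Set.univ fun w => ∀ x, x ∈ HP (w 0) →
      FmlSat (HP (upd w (n + 1) x 0)) φ (tail (upd w (n + 1) x))).congr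
      fun w _ => forall₂_congr fun x _ => ?_
    have : tail (upd w (n + 1) x) = Function.update (tail w) n x := by
      funext m
      by_cases e : m = n
      · subst e; simp [tail, upd]
      · simp [tail, upd, e]
    rw [this, upd, Function.update_of_ne (by simp)]

instance {s : Val.{u} → ZFSet.{u}} {t : Val.{u} → Val.{u}} [hs : DefF Set.univ s]
    [ht : IsRenaming t] (φ : Fml) : DefP Set.univ fun v => FmlSat (HP (s v)) φ (t v) :=
  have := IsRenaming.comp t tail
  ((defP_sat_HP φ).rename fun w => cons (w 0) (t (tail w))).subst hs

theorem mem_HP_of_mem_iff {R : Val.{u} → Prop} (hR : DefP Set.univ R) {v : Val.{u}}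
    (hv : ∀ n, Listed a (v n)) (h : ∀ y, y ∈ x ↔ R (cons y v)) (hx : ∀ y ∈ x, y ∈ HP a) :
    x ∈ HP a :=
  mem_HP_iff.2 ⟨listed_of_mem_iff hR hv h, hx⟩

theorem listed_of_mem_HP (hx : x ∈ HP a) : Listed a x := (mem_HP_iff.1 hx).1

theorem listed_cons {v : Val.{u}} (hx : Listed a x) (hv : ∀ n, Listed a (v n)) (n : ℕ) :
    Listed a (cons x v n) := by
  cases n
  · exact hx
  · exact hv _

theorem mem_HP_of_zOrd (a : ZFSet.{u}) {o : ZFSet.{u}} (ho : ZOrd o) : o ∈ HP a := by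
  induction o using ZFSet.inductionOn with
  | _ o ih => exact mem_HP_iff.2 ⟨listed_ord a ho, fun y hy => ih y hy (ZOrd_of_mem ho hy)⟩

theorem upair_mem_HP {y : ZFSet.{u}} (hx : x ∈ HP a) (hy : y ∈ HP a) :
    ({x, y} : ZFSet.{u}) ∈ HP a := by
  refine mem_HP_iff.2 ⟨?_, ?_⟩
  · exact listed_of_defF (t := fun v => {v 0, v 1}) inferInstance
      (listed_cons (listed_of_mem_HP hx) (listed_cons (listed_of_mem_HP hy) fun _ => listed_empty a))
  · intro z hz
    rcases mem_pair.1 hz with rfl | rfl <;> assumption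

theorem pair_mem_HP {y : ZFSet.{u}} (hx : x ∈ HP a) (hy : y ∈ HP a) : pair x y ∈ HP a := by
  have := upair_mem_HP hx hx
  rw [pair_eq_singleton] at this
  exact upair_mem_HP this (upair_mem_HP hx hy)

/-- The least index of `x` in the enumeration of the sets ordinal definable from `a`. -/
noncomputable def idx (a x : ZFSet.{u}) : ZFSet.{u} := least fun o => x = enum a o

instance {s t : Val.{u} → ZFSet.{u}} [hs : DefF Set.univ s] [ht : DefF Set.univ t] :
    DefF Set.univ fun v => idx (s v) (t v) :=
  DefF.comp₂ (f := idx) (by unfold idx; infer_instance) hs ht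

theorem zOrd_idx (a x : ZFSet.{u}) : ZOrd (idx a x) := zOrd_least _

theorem enum_idx (h : Listed a x) : enum a (idx a x) = x := (least_spec h).2.1.symm

theorem modelsZFC_HP (a : ZFSet.{u}) : ModelsZFC (HP a) where
  empty_mem := mem_HP_of_zOrd a zOrd_empty
  omega_mem := by
    refine mem_HP_iff.2 ⟨listed_of_defF (t := fun _ => omega) inferInstance
      (v := fun _ => ∅) fun _ => listed_empty a, fun y hy => ?_⟩
    obtain ⟨n, rfl⟩ := mem_omega_iff.1 hy
    exact mem_HP_of_zOrd a (zOrd_nat n)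
  pair_mem _ hx _ hy := upair_mem_HP hx hy
  union_mem x hx := by
    refine mem_HP_iff.2 ⟨listed_of_defF (t := fun v => ZFSet.sUnion (v 0)) inferInstance
      (v := fun _ => x) fun _ => listed_of_mem_HP hx, fun y hy => ?_⟩
    obtain ⟨z, hz, hy⟩ := mem_sUnion.1 hy
    exact classTransitive_HP a z (classTransitive_HP a x hx z hz) y hy
  power_mem x hx := by
    refine mem_HP_of_mem_iff (R := fun w => w 0 ⊆ w 1 ∧ w 0 ∈ HP (w 2)) inferInstance
      (listed_cons (listed_of_mem_HP hx) fun _ => listed_parameter) (fun y => ?_)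
      fun y hy => (mem_sep.1 hy).2
    rw [mem_sep, mem_powerset]
    rfl
  sep_mem φ v hv x hx := by
    refine mem_HP_of_mem_iff (R := fun w => w 0 ∈ w 1 ∧
      FmlSat (HP (w 2)) φ (upd (tail (tail (tail w))) 0 (w 0))) inferInstance
      (listed_cons (listed_of_mem_HP hx) (listed_cons listed_parameter
        fun n => listed_of_mem_HP (hv n))) (fun y => ?_)
      fun y hy => classTransitive_HP a x hx y (mem_sep.1 hy).1
    rw [mem_sep]
    rfl
  repl_mem φ v hv x hx := by
    obtain ⟨Q, hQ⟩ : ∃ Q : ZFSet.{u} → ZFSet.{u} → Prop, ∀ y b, Q y b ↔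
      FmlSat (HP a) φ (Function.update (Function.update v 0 y) 1 b) ∧
      ∀ b', b' ∈ HP a → FmlSat (HP a) φ (Function.update (Function.update v 0 y) 1 b') → b' = b :=
      ⟨_, fun _ _ => Iff.rfl⟩
    have hz : ∃ z : ZFSet.{u}, ∀ b, (b ∈ HP a ∧ ∃ y, y ∈ x ∧ Q y b) → b ∈ z := by
      classical
      refine ⟨ZFSet.range fun y : x => if h : ∃ b, b ∈ HP a ∧ Q y b then h.choose else ∅, ?_⟩
      rintro b ⟨hb, y, hy, hyb⟩
      rw [mem_range]
      have h : ∃ b, b ∈ HP a ∧ Q y b := ⟨b, hb, hyb⟩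
      refine ⟨⟨y, hy⟩, (dif_pos h).trans ?_⟩
      exact ((hQ _ _).1 hyb).2 _ h.choose_spec.1 ((hQ _ _).1 h.choose_spec.2).1
    refine ⟨cls fun b => b ∈ HP a ∧ ∃ y, y ∈ x ∧ Q y b, ?_, fun b => ?_⟩
    · refine mem_HP_of_mem_iff (R := fun w => w 0 ∈ HP (w 2) ∧ ∃ y, y ∈ w 1 ∧
        FmlSat (HP (w 2)) φ (upd (upd (tail (tail (tail w))) 0 y) 1 (w 0)) ∧
        ∀ b', b' ∈ HP (w 2) → FmlSat (HP (w 2)) φ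
          (upd (upd (tail (tail (tail w))) 0 y) 1 b') → b' = w 0)
        inferInstance (v := cons x (cons a v))
        (listed_cons (listed_of_mem_HP hx) (listed_cons listed_parameter
          fun n => listed_of_mem_HP (hv n))) (fun y => ?_) fun y hy => ((mem_cls hz).1 hy).1
      rw [mem_cls hz]
      simp only [hQ]
      rfl
    · rw [mem_cls hz]
      simp only [hQ]
  choice_wo x hx := by
    have hb : ∃ z : ZFSet.{u}, ∀ q, (∃ y, y ∈ x ∧ ∃ z, z ∈ x ∧ q = pair y z ∧
        idx a y ∈ idx a z) → q ∈ z := by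
      refine ⟨x.prod x, ?_⟩
      rintro q ⟨y, hy, z, hz, rfl, -⟩
      exact pair_mem_prod.2 ⟨hy, hz⟩
    refine ⟨cls fun q => ∃ y, y ∈ x ∧ ∃ z, z ∈ x ∧ q = pair y z ∧ idx a y ∈ idx a z, ?_, ?_⟩
    · refine mem_HP_of_mem_iff (R := fun w => ∃ y, y ∈ w 1 ∧ ∃ z, z ∈ w 1 ∧ w 0 = pair y z ∧
        idx (w 2) y ∈ idx (w 2) z) inferInstance
        (listed_cons (listed_of_mem_HP hx) fun _ => listed_parameter) (fun q => mem_cls hb)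
        fun q hq => ?_
      obtain ⟨y, hy, z, hz, rfl, -⟩ := (mem_cls hb).1 hq
      exact pair_mem_HP (classTransitive_HP a x hx y hy) (classTransitive_HP a x hx z hz)
    · have hl : ∀ y ∈ x, Listed a y := fun y hy =>
        listed_of_mem_HP (classTransitive_HP a x hx y hy)
      have htri : ∀ y ∈ x, ∀ z ∈ x, y = z ∨ idx a y ∈ idx a z ∨ idx a z ∈ idx a y := by
        intro y hy z hz
        rcases (zOrd_iff.1 (zOrd_idx a y)).mem_trichotomous (zOrd_iff.1 (zOrd_idx a z)) with h | h | h
        · exact Or.inr (Or.inl h)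
        · left
          rw [← enum_idx (hl y hy), h, enum_idx (hl z hz)]
        · exact Or.inr (Or.inr h)
      have hmem : ∀ y ∈ x, ∀ z ∈ x, idx a y ∈ idx a z → pair y z ∈
          cls fun q => ∃ y, y ∈ x ∧ ∃ z, z ∈ x ∧ q = pair y z ∧ idx a y ∈ idx a z :=
        fun y hy z hz h => (mem_cls hb).2 ⟨y, hy, z, hz, rfl, h⟩
      constructor
      · intro y hy z hz
        exact (htri y hy z hz).imp_right (Or.imp (hmem y hy z hz) (hmem z hz y hy))
      · intro y hyx hne
        obtain ⟨z, hz⟩ := (ZFSet.eq_empty_or_nonempty y).resolve_left hne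
        obtain ⟨_, ⟨m, hm, rfl⟩, hmin⟩ := mem_wf.has_min {o | ∃ z ∈ y, o = idx a z} ⟨_, z, hz, rfl⟩
        refine ⟨m, hm, fun b hb => ?_⟩
        rcases htri m (hyx hm) b (hyx hb) with h | h | h
        · exact Or.inl h
        · exact Or.inr (hmem _ (hyx hm) _ (hyx hb) h)
        · exact (hmin _ ⟨b, hb, rfl⟩ h).elim

end

theorem zOD_iff {x : ZFSet.{u}} : ZOD x ↔ Listed ∅ x := by
  rw [← zODp_iff_listed]
  constructor
  · rintro ⟨φ, v, hv, h⟩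
    exact ⟨φ, v, fun n => Or.inl (hv n), h⟩
  · rintro ⟨φ, v, hv, h⟩
    refine ⟨φ, v, fun n => ?_, h⟩
    rcases hv n with h | h
    · exact h
    · rw [h]; exact zOrd_empty

theorem HODc_eq : HODc = HP (∅ : ZFSet.{u}) := by
  ext x
  induction x using ZFSet.inductionOn with
  | _ x ih =>
  rw [mem_HP_iff, ← zOD_iff]
  constructor
  · rintro ⟨_, h₁, h₂⟩
    exact ⟨h₁, fun y hy => (ih y hy).1 (h₂ y hy)⟩
  · rintro ⟨h₁, h₂⟩
    exact ⟨x, h₁, fun y hy => (ih y hy).2 (h₂ y hy)⟩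

/-! ### The forcing of ordinal definable sets, coded by ordinals -/

section

variable {η A B B₁ B₂ : ZFSet.{u}}

theorem exists_zOrd_bound {x : ZFSet.{u}} (hx : ∀ y ∈ x, ZOrd y) : ∃ o, ZOrd o ∧ x ⊆ o := by
  refine ⟨(rank x).toZFSet, zOrd_toZFSet _, fun y hy => ?_⟩
  rw [← (zOrd_iff.1 (hx y hy)).toZFSet_rank_eq]
  exact Ordinal.toZFSet_mem_toZFSet_iff.2 (rank_lt_of_mem hy)

theorem vCond_iff : VCond η B ↔ Listed ∅ B ∧ B ≠ ∅ ∧ B ⊆ powerset η := by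
  rw [VCond, zOD_iff]

instance defP_vCond {s t : Val.{u} → ZFSet.{u}} [hs : DefF Set.univ s] [ht : DefF Set.univ t] :
    DefP Set.univ fun v => VCond (s v) (t v) :=
  DefP.comp₂ (R := VCond)
    ((inferInstance : DefP Set.univ fun v => Listed ∅ (v 1) ∧ ¬ v 1 = ∅ ∧ v 1 ⊆ powerset (v 0)).congr
      fun _ _ => vCond_iff.symm) hs ht

theorem enum_idx_of_vCond (h : VCond η B) : enum ∅ (idx ∅ B) = B := enum_idx (vCond_iff.1 h).1

theorem idx_inj (h₁ : VCond η B₁) (h₂ : Listed ∅ B₂) (h : idx ∅ B₁ = idx ∅ B₂) : B₁ = B₂ := by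
  rw [← enum_idx_of_vCond h₁, h, enum_idx h₂]

/-- The set of ordinal codes of the Vopěnka conditions. -/
noncomputable def codes (η : ZFSet.{u}) : ZFSet.{u} :=
  cls fun p => ∃ B, VCond η B ∧ p = idx ∅ B

/-- The order on the codes of the Vopěnka conditions. -/
noncomputable def codesLe (η : ZFSet.{u}) : ZFSet.{u} :=
  cls fun q => ∃ B₁, VCond η B₁ ∧ ∃ B₂, VCond η B₂ ∧ B₁ ⊆ B₂ ∧ q = pair (idx ∅ B₁) (idx ∅ B₂)

/-- The set of codes of the conditions which contain `A`. -/
noncomputable def codesOf (A η : ZFSet.{u}) : ZFSet.{u} :=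
  cls fun p => ∃ B, VCond η B ∧ A ∈ B ∧ p = idx ∅ B

theorem mem_codes {p : ZFSet.{u}} : p ∈ codes η ↔ ∃ B, VCond η B ∧ p = idx ∅ B := by
  refine mem_cls ⟨ZFSet.range fun B : (powerset (powerset η)) => idx ∅ B, ?_⟩
  rintro _ ⟨B, hB, rfl⟩
  exact mem_range.2 ⟨⟨B, mem_powerset.2 hB.2.2⟩, rfl⟩

theorem mem_codesOf {p : ZFSet.{u}} :
    p ∈ codesOf A η ↔ ∃ B, VCond η B ∧ A ∈ B ∧ p = idx ∅ B :=
  mem_cls ⟨codes η, fun _ ⟨B, hB, _, hp⟩ => mem_codes.2 ⟨B, hB, hp⟩⟩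

theorem mem_codesLe {q : ZFSet.{u}} : q ∈ codesLe η ↔ ∃ B₁, VCond η B₁ ∧ ∃ B₂, VCond η B₂ ∧
    B₁ ⊆ B₂ ∧ q = pair (idx ∅ B₁) (idx ∅ B₂) := by
  refine mem_cls ⟨(codes η).prod (codes η), ?_⟩
  rintro _ ⟨B₁, h₁, B₂, h₂, _, rfl⟩
  exact pair_mem_prod.2 ⟨mem_codes.2 ⟨B₁, h₁, rfl⟩, mem_codes.2 ⟨B₂, h₂, rfl⟩⟩

theorem pair_mem_codesLe (h₁ : VCond η B₁) (h₂ : VCond η B₂) :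
    pair (idx ∅ B₁) (idx ∅ B₂) ∈ codesLe η ↔ B₁ ⊆ B₂ := by
  rw [mem_codesLe]
  constructor
  · rintro ⟨C₁, hC₁, C₂, hC₂, h, e⟩
    obtain ⟨e₁, e₂⟩ := pair_inj.1 e
    rwa [idx_inj h₁ (vCond_iff.1 hC₁).1 e₁, idx_inj h₂ (vCond_iff.1 hC₂).1 e₂]
  · exact fun h => ⟨B₁, h₁, B₂, h₂, h, rfl⟩

theorem codes_mem_HP (hη : ZOrd η) : codes η ∈ HP ∅ := by
  refine mem_HP_of_mem_iff (R := fun w => ∃ B, VCond (w 1) B ∧ w 0 = idx ∅ B) inferInstance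
    (v := fun _ => η) (fun _ => listed_ord _ hη) (fun p => mem_codes) fun p hp => ?_
  obtain ⟨B, -, rfl⟩ := mem_codes.1 hp
  exact mem_HP_of_zOrd _ (zOrd_idx _ _)

theorem codesLe_mem_HP (hη : ZOrd η) : codesLe η ∈ HP ∅ := by
  refine mem_HP_of_mem_iff (R := fun w => ∃ B₁, VCond (w 1) B₁ ∧ ∃ B₂, VCond (w 1) B₂ ∧
    B₁ ⊆ B₂ ∧ w 0 = pair (idx ∅ B₁) (idx ∅ B₂)) inferInstance
    (v := fun _ => η) (fun _ => listed_ord _ hη) (fun p => mem_codesLe) fun p hp => ?_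
  obtain ⟨B₁, -, B₂, -, -, rfl⟩ := mem_codesLe.1 hp
  exact pair_mem_HP (mem_HP_of_zOrd _ (zOrd_idx _ _)) (mem_HP_of_zOrd _ (zOrd_idx _ _))

theorem codesOf_mem_HP (hη : ZOrd η) : codesOf A η ∈ HP A := by
  refine mem_HP_of_mem_iff (R := fun w => ∃ B, VCond (w 1) B ∧ w 2 ∈ B ∧ w 0 = idx ∅ B)
    inferInstance (v := cons η fun _ => A)
    (listed_cons (listed_ord _ hη) fun _ => listed_parameter) (fun p => mem_codesOf) fun p hp => ?_
  obtain ⟨B, -, -, rfl⟩ := mem_codesOf.1 hp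
  exact mem_HP_of_zOrd _ (zOrd_idx _ _)

theorem zPoset_codes (η : ZFSet.{u}) : ZPoset (codes η) (codesLe η) where
  rel z hz := by
    obtain ⟨B₁, h₁, B₂, h₂, -, rfl⟩ := mem_codesLe.1 hz
    exact ⟨_, mem_codes.2 ⟨B₁, h₁, rfl⟩, _, mem_codes.2 ⟨B₂, h₂, rfl⟩, rfl⟩
  refl p hp := by
    obtain ⟨B, h, rfl⟩ := mem_codes.1 hp
    exact (pair_mem_codesLe h h).2 fun _ => id
  antisymm p q hpq hqp := by
    obtain ⟨B₁, h₁, B₂, h₂, h, e⟩ := mem_codesLe.1 hpq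
    obtain ⟨rfl, rfl⟩ := pair_inj.1 e
    rw [h.antisymm ((pair_mem_codesLe h₂ h₁).1 hqp)]
  trans p q r hpq hqr := by
    obtain ⟨B₁, h₁, B₂, h₂, h, e⟩ := mem_codesLe.1 hpq
    obtain ⟨C₁, h₃, C₂, h₄, h', e'⟩ := mem_codesLe.1 hqr
    obtain ⟨rfl, rfl⟩ := pair_inj.1 e
    obtain ⟨e, rfl⟩ := pair_inj.1 e'
    rw [← idx_inj h₂ (vCond_iff.1 h₃).1 e] at h'
    exact (pair_mem_codesLe h₁ h₄).2 fun _ hx => h' (h hx)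

theorem vCond_of_mem_iff {R : Val.{u} → Prop} (hR : DefP Set.univ R) {v : Val.{u}}
    (hv : ∀ n, Listed ∅ (v n)) (h : ∀ y, y ∈ B ↔ R (cons y v)) (hA : A ∈ B)
    (hB : ∀ y ∈ B, y ⊆ η) : VCond η B :=
  vCond_iff.2 ⟨listed_of_mem_iff hR hv h, fun e => notMem_empty A (e ▸ hA),
    fun y hy => mem_powerset.2 (hB y hy)⟩

theorem zFilter_codesOf (hη : ZOrd η) (hA : A ⊆ η) :
    ZFilter (codes η) (codesLe η) {p | ∃ B, VCond η B ∧ A ∈ B ∧ p = idx ∅ B} := by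
  refine ⟨?_, ⟨_, powerset η, ?_, mem_powerset.2 hA, rfl⟩, ?_, ?_⟩
  · rintro _ ⟨B, hB, -, rfl⟩
    exact mem_codes.2 ⟨B, hB, rfl⟩
  · exact vCond_of_mem_iff (R := fun w => w 0 ∈ powerset (w 1)) inferInstance (v := fun _ => η)
      (fun _ => listed_ord _ hη) (fun _ => Iff.rfl) (mem_powerset.2 hA) fun y => mem_powerset.1
  · rintro _ ⟨B, hB, hAB, rfl⟩ q hq hle
    obtain ⟨C, hC, rfl⟩ := mem_codes.1 hq
    exact ⟨C, hC, (pair_mem_codesLe hB hC).1 hle hAB, rfl⟩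
  · rintro _ ⟨B, hB, hAB, rfl⟩ _ ⟨C, hC, hAC, rfl⟩
    have h : VCond η (B ∩ C) :=
      vCond_of_mem_iff (R := fun w => w 0 ∈ w 1 ∧ w 0 ∈ w 2) inferInstance
        (v := cons B fun _ => C) (listed_cons (vCond_iff.1 hB).1 fun _ => (vCond_iff.1 hC).1)
        (fun _ => mem_inter) (mem_inter.2 ⟨hAB, hAC⟩)
        fun y hy => mem_powerset.1 (hB.2.2 (mem_inter.1 hy).1)
    exact ⟨_, ⟨B ∩ C, h, mem_inter.2 ⟨hAB, hAC⟩, rfl⟩,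
      (pair_mem_codesLe h hB).2 fun _ hx => (mem_inter.1 hx).1,
      (pair_mem_codesLe h hC).2 fun _ hx => (mem_inter.1 hx).2⟩

theorem zGeneric_codesOf (hη : ZOrd η) (hA : A ⊆ η) :
    ZGeneric HODc (codes η) (codesLe η) {p | ∃ B, VCond η B ∧ A ∈ B ∧ p = idx ∅ B} := by
  refine ⟨zFilter_codesOf hη hA, fun D hD hdense => ?_⟩
  rw [HODc_eq] at hD
  by_contra hcon
  have hAD : ∀ p ∈ D, A ∉ enum ∅ p := fun p hp hAp => by
    obtain ⟨B, hB, rfl⟩ := mem_codes.1 (hdense.1 hp)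
    rw [enum_idx_of_vCond hB] at hAp
    exact hcon ⟨_, ⟨B, hB, hAp, rfl⟩, hp⟩
  have hC : VCond η ((powerset η).sep fun a => ∀ p, p ∈ D → a ∉ enum ∅ p) :=
    vCond_of_mem_iff (R := fun w => w 0 ∈ powerset (w 1) ∧ ∀ p, p ∈ w 2 → ¬ w 0 ∈ enum ∅ p)
      inferInstance (v := cons η fun _ => D)
      (listed_cons (listed_ord _ hη) fun _ => listed_of_mem_HP hD) (fun _ => mem_sep)
      (mem_sep.2 ⟨mem_powerset.2 hA, hAD⟩) fun y hy => mem_powerset.1 (mem_sep.1 hy).1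
  obtain ⟨q, hq, hle⟩ := hdense.2 _ (mem_codes.2 ⟨_, hC, rfl⟩)
  obtain ⟨B, hB, rfl⟩ := mem_codes.1 (hdense.1 hq)
  obtain ⟨a, ha⟩ := (ZFSet.eq_empty_or_nonempty B).resolve_left hB.2.1
  refine (mem_sep.1 ((pair_mem_codesLe hB hC).1 hle ha)).2 _ hq ?_
  rwa [enum_idx_of_vCond hB]

theorem odMap_idx (η : ZFSet.{u}) : ODMap (idx ∅) {B | VCond η B} := by
  obtain ⟨φ, hφ⟩ :=
    (inferInstance : DefP Set.univ fun w : Val.{u} => w 1 = idx ∅ (w 0)).out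
  refine ⟨φ, fun _ => ∅, fun _ => zOrd_empty, fun B _ y => ?_⟩
  rw [hφ _ fun _ => trivial]
  simp

theorem HP_empty_subset (a : ZFSet.{u}) : HP ∅ ⊆ HP a := by
  intro x hx
  induction x using ZFSet.inductionOn with
  | _ x ih =>
  obtain ⟨h, hx⟩ := mem_HP_iff.1 hx
  refine mem_HP_iff.2 ⟨?_, fun y hy => ih y hy (hx y hy)⟩
  obtain ⟨o, ho, rfl⟩ := h
  exact listed_of_defF (t := fun v => enum ∅ (v 0)) inferInstance (v := fun _ => o)
    fun _ => listed_ord a ho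

theorem parameter_mem_HP (hA : ∀ x ∈ A, ZOrd x) : A ∈ HP A :=
  mem_HP_iff.2 ⟨listed_parameter, fun x hx => mem_HP_of_zOrd A (hA x hx)⟩

end

/-! ### Transitive models of set theory -/

section

variable {N : ZClass.{u}} {R : Val.{u} → Prop} {v : Val.{u}} {x y : ZFSet.{u}}

theorem cons_mem (hx : x ∈ N) (hv : ∀ n, v n ∈ N) (n : ℕ) : cons x v n ∈ N := by
  cases n
  · exact hx
  · exact hv _

theorem insert_mem (hM : ModelsZFC N) (hx : x ∈ N) (hy : y ∈ N) : insert x y ∈ N := by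
  have h₁ := hM.pair_mem x hx x hx
  have h := hM.union_mem _ (hM.pair_mem _ h₁ y hy)
  convert h using 1
  ext z
  simp

variable [hN : TransClass N]

theorem mem_of_mem_iff (hM : ModelsZFC N) (hR : DefP N R) (hv : ∀ n, v n ∈ N) (hx : x ∈ N)
    (h : ∀ z, z ∈ y ↔ z ∈ x ∧ R (cons z v)) : y ∈ N := by
  obtain ⟨φ, hφ⟩ := hR.out
  have := hM.sep_mem φ (cons ∅ v) (cons_mem hM.empty_mem hv) x hx
  convert this using 1
  ext z
  rw [h, mem_sep]
  refine and_congr_right fun hz => ?_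
  have e : Function.update (cons ∅ v) 0 z = cons z v := by
    funext n
    cases n <;> rfl
  rw [e, hφ _ (cons_mem (hN.out x hx z hz) hv)]

theorem exists_image (hM : ModelsZFC N) (hR : DefP N R) (hv : ∀ n, v n ∈ N) (hx : x ∈ N)
    (hf : ∀ a ∈ x, ∀ b ∈ N, ∀ b' ∈ N, R (cons a (cons b v)) → R (cons a (cons b' v)) → b' = b) :
    ∃ z ∈ N, ∀ b, b ∈ z ↔ b ∈ N ∧ ∃ a, a ∈ x ∧ R (cons a (cons b v)) := by
  obtain ⟨φ, hφ⟩ := hR.out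
  obtain ⟨z, hz, h⟩ := hM.repl_mem φ (cons ∅ (cons ∅ v))
    (cons_mem hM.empty_mem (cons_mem hM.empty_mem hv)) x hx
  refine ⟨z, hz, fun b => (h b).trans (and_congr_right fun hb => exists_congr fun a =>
    and_congr_right fun ha => ?_)⟩
  have e : ∀ b ∈ N, FmlSat N φ (Function.update (Function.update (cons ∅ (cons ∅ v)) 0 a) 1 b) ↔
      R (cons a (cons b v)) := by
    intro b hb
    rw [← hφ _ (cons_mem (hN.out x hx a ha) (cons_mem hb hv))]
    refine iff_of_eq (congrArg _ (funext fun n => ?_))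
    rcases n with _ | _ | n <;> rfl
  rw [e b hb]
  exact ⟨And.left, fun hR => ⟨hR, fun b' hb' h' => hf a ha b hb b' hb' hR ((e b' hb').1 h')⟩⟩

theorem mem_of_pair_mem {f a b : ZFSet.{u}} (hf : f ∈ N) (h : pair a b ∈ f) : a ∈ N ∧ b ∈ N := by
  have h₁ := hN.out _ (hN.out f hf _ h) {a, b} (by simp [pair])
  exact ⟨hN.out _ h₁ a (by simp), hN.out _ h₁ b (by simp)⟩

/-! ### The collapse of a coded structure -/

/-- `f` is a partial collapse of the structure with domain `I` and membership relation `E`. -/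
def IsCollapse (N : ZClass.{u}) (I E f : ZFSet.{u}) : Prop :=
  ∀ ξ, ξ ∈ I → ∀ w, w ∈ N → pair ξ w ∈ f →
    (∀ ζ, ζ ∈ I → pair ζ ξ ∈ E → ∃ y, y ∈ w ∧ pair ζ y ∈ f) ∧
    ∀ y, y ∈ w → ∃ ζ, ζ ∈ I ∧ pair ζ ξ ∈ E ∧ pair ζ y ∈ f

variable {I E f : ZFSet.{u}} {e : ZFSet.{u} → ZFSet.{u}}

theorem IsCollapse.eq (hf : IsCollapse N I E f)
    (hE : ∀ ζ ∈ I, ∀ ξ ∈ I, pair ζ ξ ∈ E ↔ e ζ ∈ e ξ)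
    (hI : ∀ ξ ∈ I, ∀ y ∈ e ξ, ∃ ζ ∈ I, e ζ = y) {ξ w : ZFSet.{u}} (hξ : ξ ∈ I) (hw : w ∈ N)
    (h : pair ξ w ∈ f) : w = e ξ := by
  induction hs : e ξ using ZFSet.inductionOn generalizing ξ w with
  | _ s ih =>
  subst hs
  obtain ⟨h₁, h₂⟩ := hf ξ hξ w hw h
  ext y
  constructor
  · intro hy
    obtain ⟨ζ, hζ, hζξ, hp⟩ := h₂ y hy
    rw [hE ζ hζ ξ hξ] at hζξ
    rwa [ih _ hζξ hζ (hN.out w hw y hy) hp rfl]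
  · intro hy
    obtain ⟨ζ, hζ, rfl⟩ := hI ξ hξ y hy
    obtain ⟨y, hyw, hp⟩ := h₁ ζ hζ ((hE ζ hζ ξ hξ).2 hy)
    rwa [← ih _ hy hζ (hN.out w hw y hyw) hp rfl]

instance defP_isCollapse [PairClosed N] {r s t : Val.{u} → ZFSet.{u}} [hr : DefF N r]
    [hs : DefF N s] [ht : DefF N t] : DefP N fun v => IsCollapse N (r v) (s v) (t v) :=
  DefP.comp₃ (R := IsCollapse N) (by unfold IsCollapse; infer_instance) hr hs ht

theorem mem_of_collapse (hM : ModelsZFC N) (hIN : I ∈ N) (hEN : E ∈ N)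
    (hE : ∀ ζ ∈ I, ∀ ξ ∈ I, pair ζ ξ ∈ E ↔ e ζ ∈ e ξ)
    (hI : ∀ ξ ∈ I, ∀ y ∈ e ξ, ∃ ζ ∈ I, e ζ = y) {ξ : ZFSet.{u}} (hξ : ξ ∈ I) : e ξ ∈ N := by
  have : PairClosed N := ⟨hM.pair_mem⟩
  obtain ⟨h, hN', hh⟩ : ∃ h ∈ N, ∀ b, b ∈ h ↔ b ∈ N ∧ ∃ ξ, ξ ∈ I ∧ ∃ w, w ∈ N ∧ b = pair ξ w ∧
      ∃ f, f ∈ N ∧ IsCollapse N I E f ∧ b ∈ f := by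
    refine exists_image hM (R := fun v => ∃ w, w ∈ N ∧ v 1 = pair (v 0) w ∧
      ∃ f, f ∈ N ∧ IsCollapse N (v 2) (v 3) f ∧ v 1 ∈ f) (v := cons I fun _ => E)
      inferInstance (cons_mem hIN fun _ => hEN) hIN ?_
    rintro ξ hξ b - b' - ⟨w, hw, hb, f, -, hf, hp⟩ ⟨w', hw', hb', f', -, hf', hp'⟩
    change b = pair ξ w at hb
    change b' = pair ξ w' at hb'
    subst hb hb'
    rw [hf.eq hE hI hξ hw hp, hf'.eq hE hI hξ hw' hp']
  have hpair : ∀ ξ ∈ I, ∀ w, pair ξ w ∈ h ↔ w ∈ N ∧ ∃ f, f ∈ N ∧ IsCollapse N I E f ∧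
      pair ξ w ∈ f := by
    intro ξ hξ w
    rw [hh]
    constructor
    · rintro ⟨-, ξ', -, w', hw', e, hf⟩
      exact ⟨(pair_inj.1 e).2 ▸ hw', hf⟩
    · rintro ⟨hw, f, hfN, hf⟩
      exact ⟨hN.out f hfN _ hf.2, ξ, hξ, w, hw, rfl, f, hfN, hf⟩
  have hcol : IsCollapse N I E h := by
    intro ξ hξ w hw hp
    obtain ⟨-, f, hfN, hf, hp⟩ := (hpair ξ hξ w).1 hp
    obtain ⟨h₁, h₂⟩ := hf ξ hξ w hw hp
    constructor
    · intro ζ hζ hζξ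
      obtain ⟨y, hy, hp⟩ := h₁ ζ hζ hζξ
      exact ⟨y, hy, (hpair ζ hζ y).2 ⟨hN.out w hw y hy, f, hfN, hf, hp⟩⟩
    · intro y hy
      obtain ⟨ζ, hζ, hζξ, hp⟩ := h₂ y hy
      exact ⟨ζ, hζ, hζξ, (hpair ζ hζ y).2 ⟨hN.out w hw y hy, f, hfN, hf, hp⟩⟩
  suffices pair ξ (e ξ) ∈ h from ((hpair ξ hξ _).1 this).1
  induction hs : e ξ using ZFSet.inductionOn generalizing ξ with
  | _ s ih =>
  subst hs
  have hrec : ∀ ζ ∈ I, pair ζ ξ ∈ E → e ζ ∈ e ξ ∧ pair ζ (e ζ) ∈ h := fun ζ hζ hζξ =>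
    have hζξ := (hE ζ hζ ξ hξ).1 hζξ
    ⟨hζξ, ih _ hζξ hζ rfl⟩
  have hmem : ∀ y, y ∈ e ξ ↔ ∃ ζ, ζ ∈ I ∧ pair ζ ξ ∈ E ∧ pair ζ y ∈ h := by
    intro y
    constructor
    · intro hy
      obtain ⟨ζ, hζ, rfl⟩ := hI ξ hξ y hy
      have := (hE ζ hζ ξ hξ).2 hy
      exact ⟨ζ, hζ, this, (hrec ζ hζ this).2⟩
    · rintro ⟨ζ, hζ, hζξ, hp⟩
      rw [hcol.eq hE hI hζ (mem_of_pair_mem hN' hp).2 hp]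
      exact (hrec ζ hζ hζξ).1
  have heN : e ξ ∈ N := by
    refine mem_of_mem_iff hM (R := fun v => ∃ ζ, ζ ∈ v 1 ∧ pair ζ (v 2) ∈ v 3 ∧
      pair ζ (v 0) ∈ v 4) (v := cons I (cons ξ (cons E fun _ => h))) inferInstance
      (cons_mem hIN (cons_mem (hN.out I hIN ξ hξ) (cons_mem hEN fun _ => hN')))
      (hM.union_mem _ (hM.union_mem _ hN')) fun y => ?_
    refine (hmem y).trans ⟨fun hy => ⟨?_, hy⟩, And.right⟩
    obtain ⟨ζ, -, -, hp⟩ := hy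
    exact mem_sUnion.2 ⟨{ζ, y}, mem_sUnion.2 ⟨_, hp, by simp [pair]⟩, by simp⟩
  have hpN : pair ξ (e ξ) ∈ N :=
    (inferInstance : DefF N fun v => pair (v 0) (v 1)).closed (cons ξ fun _ => e ξ)
      (cons_mem (hN.out I hIN ξ hξ) fun _ => heN)
  refine (hpair ξ hξ _).2 ⟨heN, _, insert_mem hM hpN hN', ?_, mem_insert _ _⟩
  intro ζ hζ w hw hp
  rcases mem_insert_iff.1 hp with hp | hp
  · obtain ⟨rfl, rfl⟩ := pair_inj.1 hp
    refine ⟨fun ζ' hζ' hE' => ?_, fun y hy => ?_⟩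
    · exact ⟨e ζ', (hrec ζ' hζ' hE').1, mem_insert_of_mem _ (hrec ζ' hζ' hE').2⟩
    · obtain ⟨ζ', hζ', hE', hp⟩ := (hmem y).1 hy
      exact ⟨ζ', hζ', hE', mem_insert_of_mem _ hp⟩
  · obtain ⟨h₁, h₂⟩ := hcol ζ hζ w hw hp
    refine ⟨fun ζ' hζ' hE' => ?_, fun y hy => ?_⟩
    · obtain ⟨y, hy, hp⟩ := h₁ ζ' hζ' hE'
      exact ⟨y, hy, mem_insert_of_mem _ hp⟩
    · obtain ⟨ζ', hζ', hE', hp⟩ := h₂ y hy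
      exact ⟨ζ', hζ', hE', mem_insert_of_mem _ hp⟩

/-! ### Minimality of the extension -/

variable {A η X Y g : ZFSet.{u}}

theorem mem_of_definable_subset (hM : ModelsZFC N) (hsub : HP ∅ ⊆ N) (hη : ZOrd η) (hA : A ⊆ η)
    (hgN : g ∈ N) (hg : ∀ p, p ∈ g ↔ ∃ B, VCond η B ∧ A ∈ B ∧ p = idx ∅ B) (hX : X ∈ HP ∅)
    (hR : DefP Set.univ R) (hv : ∀ n, Listed ∅ (v n))
    (hY : ∀ z, z ∈ Y ↔ z ∈ X ∧ R (cons z (cons A v))) : Y ∈ N := by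
  have : PairClosed N := ⟨hM.pair_mem⟩
  obtain ⟨B, hB⟩ : ∃ B : ZFSet.{u} → ZFSet.{u}, ∀ z a, a ∈ B z ↔ a ⊆ η ∧ R (cons z (cons a v)) :=
    ⟨fun z => (powerset η).sep fun a => R (cons z (cons a v)), fun z a => by
      rw [mem_sep, mem_powerset]⟩
  have hX' : ∀ z ∈ X, z ∈ HP ∅ := fun z => classTransitive_HP ∅ X hX z
  have hBl : ∀ z ∈ X, Listed ∅ (B z) := fun z hz => by
    have h := hR.rename fun w : Val.{u} => cons (w 1) (cons (w 0) (tail (tail (tail w))))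
    exact listed_of_mem_iff (R := fun w => w 0 ⊆ w 2 ∧
      R (cons (w 1) (cons (w 0) (tail (tail (tail w)))))) inferInstance
      (v := cons z (cons η v)) (listed_cons (listed_of_mem_HP (hX' z hz))
        (listed_cons (listed_ord _ hη) hv)) (hB z)
  obtain ⟨h, hh⟩ : ∃ h : ZFSet.{u}, ∀ q, q ∈ h ↔ ∃ z, z ∈ X ∧ q = pair z (idx ∅ (B z)) :=
    ⟨ZFSet.range fun z : X => pair z (idx ∅ (B z)), fun q => by
      simp only [mem_range, Subtype.exists, eq_comm]
      exact ⟨fun ⟨z, hz, e⟩ => ⟨z, hz, e⟩, fun ⟨z, hz, e⟩ => ⟨z, hz, e⟩⟩⟩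
  have hhP : h ∈ HP ∅ := by
    have h' := hR.rename fun w : Val.{u} =>
      cons (tail (tail w) 0) (cons (w 0) (tail (tail (tail (tail (tail (tail w)))))))
    refine mem_HP_of_mem_iff (R := fun w => ∃ z, z ∈ w 1 ∧ ∃ b, (∀ a, a ∈ b ↔ a ⊆ w 2 ∧
      R (cons z (cons a (tail (tail (tail w)))))) ∧ w 0 = pair z (idx ∅ b)) inferInstance
      (v := cons X (cons η v)) (listed_cons (listed_of_mem_HP hX)
        (listed_cons (listed_ord _ hη) hv)) (fun q => ?_) fun q hq => ?_
    · rw [hh]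
      refine exists_congr fun z => and_congr_right fun _ => ?_
      constructor
      · exact fun e => ⟨B z, hB z, e⟩
      · rintro ⟨b, hb, e⟩
        have : b = B z := by
          ext a
          exact (hb a).trans (hB z a).symm
        exact this ▸ e
    · obtain ⟨z, hz, rfl⟩ := (hh q).1 hq
      exact pair_mem_HP (hX' z hz) (mem_HP_of_zOrd _ (zOrd_idx _ _))
  refine mem_of_mem_iff hM (R := fun w => ∃ p, p ∈ w 1 ∧ pair (w 0) p ∈ w 2) inferInstance
    (v := cons g fun _ => h) (cons_mem hgN fun _ => hsub hhP) (hsub hX) fun z => ?_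
  rw [hY]
  refine and_congr_right fun hz => ?_
  constructor
  · intro hR
    have hAB : A ∈ B z := (hB z A).2 ⟨hA, hR⟩
    refine ⟨idx ∅ (B z), (hg _).2 ⟨B z, vCond_iff.2 ⟨hBl z hz, fun e => ?_, fun a ha => ?_⟩, hAB,
      rfl⟩, (hh _).2 ⟨z, hz, rfl⟩⟩
    · exact notMem_empty A (e ▸ hAB)
    · exact mem_powerset.2 ((hB z a).1 ha).1
  · rintro ⟨p, hp, hzp⟩
    obtain ⟨C, hC, hAC, rfl⟩ := (hg p).1 hp
    obtain ⟨z', -, e⟩ := (hh _).1 hzp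
    obtain ⟨e₁, e₂⟩ := pair_inj.1 e
    simp only [cons_zero] at e₁
    subst e₁
    rw [idx_inj hC (hBl z hz) e₂] at hAC
    exact ((hB z A).1 hAC).2

theorem HP_subset (hM : ModelsZFC N) (hsub : HP ∅ ⊆ N) (hη : ZOrd η) (hA : A ⊆ η)
    (hgN : g ∈ N) (hg : ∀ p, p ∈ g ↔ ∃ B, VCond η B ∧ A ∈ B ∧ p = idx ∅ B) : HP A ⊆ N := by
  intro x hx
  obtain ⟨ξ, hξ, hxξ⟩ := listed_of_mem_HP hx
  have hT : ∀ y, (∀ t : ZFSet.{u}, t.IsTransitive → x ∈ t → y ∈ t) →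
      y ∈ vonNeumann (Order.succ (rank x)) ∧ Listed A y := by
    intro y hy
    have := hy ((vonNeumann (Order.succ (rank x))).sep (· ∈ HP A)) ?_ ?_
    · exact ⟨(mem_sep.1 this).1, listed_of_mem_HP (mem_sep.1 this).2⟩
    · intro y hy z hz
      rw [mem_sep] at hy ⊢
      exact ⟨(isTransitive_vonNeumann _).subset_of_mem hy.1 hz, classTransitive_HP A y hy.2 z hz⟩
    · exact mem_sep.2 ⟨mem_vonNeumann.2 (Order.lt_succ _), hx⟩
  obtain ⟨θ, hθ, hbd⟩ := exists_zOrd_bound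
    (x := ZFSet.range fun y : (vonNeumann (Order.succ (rank x))) => idx A y) fun o ho => by
      obtain ⟨y, rfl⟩ := mem_range.1 ho
      exact zOrd_idx _ _
  have hidx : ∀ y, (∀ t : ZFSet.{u}, t.IsTransitive → x ∈ t → y ∈ t) → idx A y ∈ θ := fun y hy =>
    hbd (mem_range.2 ⟨⟨y, (hT y hy).1⟩, rfl⟩)
  have hθP := mem_HP_of_zOrd ∅ hθ
  have hprod : θ.prod θ ∈ HP ∅ := by
    refine mem_HP_iff.2 ⟨listed_of_defF (t := fun v => ZFSet.prod (v 0) (v 0)) inferInstance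
      (v := fun _ => θ) fun _ => listed_ord _ hθ, fun q hq => ?_⟩
    obtain ⟨a, ha, b, hb, rfl⟩ := mem_prod.1 hq
    exact pair_mem_HP (classTransitive_HP _ _ hθP a ha) (classTransitive_HP _ _ hθP b hb)
  have hIN : (θ.sep fun o => ∀ t : ZFSet.{u}, t.IsTransitive → x ∈ t → enum A o ∈ t) ∈ N := by
    refine mem_of_definable_subset hM hsub hη hA hgN hg hθP (R := fun w => ∀ t : ZFSet.{u},
      t.IsTransitive → enum (w 1) (w 2) ∈ t → enum (w 1) (w 0) ∈ t) inferInstance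
      (v := fun _ => ξ) (fun _ => listed_ord _ hξ) fun o => ?_
    rw [mem_sep, hxξ]
    rfl
  have hEN : ((θ.prod θ).sep fun q => ∃ a b, q = pair a b ∧ enum A a ∈ enum A b) ∈ N :=
    mem_of_definable_subset hM hsub hη hA hgN hg hprod (R := fun w => ∃ a b,
      w 0 = pair a b ∧ enum (w 1) a ∈ enum (w 1) b) inferInstance
      (v := fun _ => ∅) (fun _ => listed_empty _) fun q => mem_sep
  have key := mem_of_collapse (e := enum A) (ξ := idx A x) hM hIN hEN ?_ ?_ ?_
  · rwa [enum_idx (listed_of_mem_HP hx)] at key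
  · intro a ha b hb
    rw [mem_sep, pair_mem_prod]
    constructor
    · rintro ⟨-, a', b', e, h⟩
      obtain ⟨rfl, rfl⟩ := pair_inj.1 e
      exact h
    · exact fun h => ⟨⟨(mem_sep.1 ha).1, (mem_sep.1 hb).1⟩, a, b, rfl, h⟩
  · intro a ha y hy
    have hyT : ∀ t : ZFSet.{u}, t.IsTransitive → x ∈ t → y ∈ t := fun t ht hxt =>
      ht.subset_of_mem ((mem_sep.1 ha).2 t ht hxt) hy
    have e := enum_idx (hT y hyT).2
    exact ⟨idx A y, mem_sep.2 ⟨hidx y hyT, by rwa [e]⟩, e⟩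
  · rw [mem_sep, enum_idx (listed_of_mem_HP hx)]
    exact ⟨hidx x fun _ _ h => h, fun _ _ h => h⟩

end

end Vopenka

open Vopenka in
/-- (Vopěnka) For every set of ordinals `A` there is a forcing `ℙ ∈ HOD` and a
`(HOD,ℙ)`-generic filter `G` with `A ∈ HOD[G] ⊆ V`; moreover `ℙ` is (an ordinal-coded
isomorph of) the partial order of nonempty OD subsets of `P(sup A + 1)` ordered by
inclusion, and `G` is definable from `A` and `ℙ` as the set of codes of conditions
containing `A`. -/
theorem vopenka_forcing (A : ZFSet) (hA : ∀ a ∈ A, ZOrd a) :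
    ∃ (η P le : ZFSet) (c : ZFSet → ZFSet) (G : Set ZFSet) (HG : ZClass),
      ZOrd η ∧ A ⊆ η ∧
      P ∈ HODc ∧ le ∈ HODc ∧ ZPoset P le ∧
      ODMap c {B | VCond η B} ∧
      (∀ B : ZFSet, VCond η B → ZOrd (c B) ∧ c B ∈ P) ∧
      (∀ B₁ B₂ : ZFSet, VCond η B₁ → VCond η B₂ → c B₁ = c B₂ → B₁ = B₂) ∧
      (∀ p : ZFSet, p ∈ P → ∃ B : ZFSet, VCond η B ∧ p = c B) ∧
      (∀ B₁ B₂ : ZFSet, VCond η B₁ → VCond η B₂ →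
        (ZFSet.pair (c B₁) (c B₂) ∈ le ↔ B₁ ⊆ B₂)) ∧
      G = {p : ZFSet | ∃ B : ZFSet, VCond η B ∧ A ∈ B ∧ p = c B} ∧
      ZGeneric HODc P le G ∧
      IsGenericExt HODc G HG ∧ A ∈ HG ∧ HG ⊆ Set.univ := by
  obtain ⟨η, hη, hAη⟩ := exists_zOrd_bound hA
  refine ⟨η, codes η, codesLe η, idx ∅, _, HP A, hη, hAη, HODc_eq ▸ codes_mem_HP hη,
    HODc_eq ▸ codesLe_mem_HP hη, zPoset_codes η, odMap_idx η,
    fun B hB => ⟨zOrd_idx _ _, mem_codes.2 ⟨B, hB, rfl⟩⟩,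
    fun B₁ B₂ h₁ h₂ => idx_inj h₁ (vCond_iff.1 h₂).1, fun p => mem_codes.1,
    fun B₁ B₂ => pair_mem_codesLe, rfl, zGeneric_codesOf hη hAη,
    ⟨classTransitive_HP A, modelsZFC_HP A, HODc_eq ▸ HP_empty_subset A,
      ⟨codesOf A η, codesOf_mem_HP hη, fun p => mem_codesOf⟩, ?_⟩,
    parameter_mem_HP hA, Set.subset_univ _⟩
  rintro N hN hM hsub ⟨g, hgN, hg⟩
  have : TransClass N := ⟨hN⟩
  exact HP_subset hM (HODc_eq ▸ hsub) hη hAη hgN hg
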